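/- Suppose A is a unital C*-algebra, M is a von Neumann algebra on a complex Hilbert space, π: A → M is a unital *-homomorphism, and ρ lies in the closure (in the topology of pointwise norm convergence) of the unitary orbit {a ↦ u* π(a) u : u unitary in M} of π. Then for every a ∈ A, M-rank(π(a)) = M-rank(ρ(a)); that is, the range projections R(π(a)) and R(ρ(a)) are Murray–von Neumann equivalent in M. -/

import Mathlib

/-- `r` is the orthogonal projection onto the closure of the range of `T`. -/
def IsRangeProjection {H : Type*} [NormedAddCommGroup H] [InnerProductSpace ℂ H]
    [CompleteSpace H] (r T : H →L[ℂ] H) : Prop :=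
  r * r = r ∧ IsSelfAdjoint r ∧ Set.range r = closure (Set.range T)

/-- The unitary orbit of a representation `π : A → B(H)` under conjugation by unitaries of a
von Neumann algebra `M`, as a set of functions `A → B(H)` (with the topology of pointwise
norm convergence, i.e. the product topology). -/
def unitaryOrbitVN {A H : Type*} [CStarAlgebra A] [NormedAddCommGroup H]
    [InnerProductSpace ℂ H] [CompleteSpace H] (M : VonNeumannAlgebra H)
    (π : A →⋆ₐ[ℂ] (H →L[ℂ] H)) : Set (A → (H →L[ℂ] H)) :=
  {f | ∃ u : H →L[ℂ] H, u ∈ M ∧ u ∈ unitary (H →L[ℂ] H) ∧ f = fun a => star u * π a * u}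

section VonNeumann

open scoped InnerProductSpace

variable {H : Type*} [NormedAddCommGroup H] [InnerProductSpace ℂ H] [CompleteSpace H]

/-- The orthogonal projection onto the closure of a subspace. -/
noncomputable def closureProj (N : Submodule ℂ H) : H →L[ℂ] H :=
  N.topologicalClosure.starProjection

theorem isStarProjection_closureProj (N : Submodule ℂ H) : IsStarProjection (closureProj N) :=
  isStarProjection_starProjection

theorem closureProj_apply_of_mem {N : Submodule ℂ H} {x : H} (hx : x ∈ N) :
    closureProj N x = x :=
  Submodule.starProjection_eq_self_iff.2 (N.le_topologicalClosure hx)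

theorem mul_closureProj_congr {N : Submodule ℂ H} {a b : H →L[ℂ] H}
    (h : ∀ x ∈ N, a x = b x) : a * closureProj N = b * closureProj N := by
  ext x
  have hx : closureProj N x ∈ closure (N : Set H) := by
    rw [← Submodule.topologicalClosure_coe]
    exact Submodule.starProjection_apply_mem _ _
  exact Set.EqOn.closure (fun y hy => h y hy) a.continuous b.continuous hx

theorem commute_closureProj {N : Submodule ℂ H} {y : H →L[ℂ] H}
    (h : ∀ x ∈ N, y x ∈ N) (h' : ∀ x ∈ N, star y x ∈ N) : Commute y (closureProj N) := by
  have key : ∀ y : H →L[ℂ] H, (∀ x ∈ N, y x ∈ N) →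
      closureProj N * y * closureProj N = y * closureProj N := fun y h =>
    mul_closureProj_congr fun x hx => closureProj_apply_of_mem (h x hx)
  have h1 := key y h
  have h2 := congr(star $(key (star y) h'))
  simp only [star_mul, star_star, (isStarProjection_closureProj N).isSelfAdjoint.star_eq,
    ← mul_assoc] at h2
  exact h1.symm.trans h2

/-- The projection onto the closure of the range of an operator. -/
noncomputable def rangeProj (t : H →L[ℂ] H) : H →L[ℂ] H := closureProj t.range

theorem isStarProjection_rangeProj (t : H →L[ℂ] H) : IsStarProjection (rangeProj t) :=
  isStarProjection_closureProj _

theorem rangeProj_mul (t : H →L[ℂ] H) : rangeProj t * t = t := by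
  ext x
  exact closureProj_apply_of_mem (N := t.range) ⟨x, rfl⟩

theorem mul_rangeProj_congr {t a b : H →L[ℂ] H} (h : a * t = b * t) :
    a * rangeProj t = b * rangeProj t :=
  mul_closureProj_congr fun _ ⟨x, hx⟩ => hx ▸ congr($h x)

theorem isRangeProjection_rangeProj (t : H →L[ℂ] H) : IsRangeProjection (rangeProj t) t := by
  refine ⟨(isStarProjection_rangeProj t).isIdempotentElem,
    (isStarProjection_rangeProj t).isSelfAdjoint, ?_⟩
  change _ = closure (t.range : Set H)
  rw [← Submodule.topologicalClosure_coe,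
    ← Submodule.range_starProjection t.range.topologicalClosure]
  rfl

theorem mem_of_commute_commutant {M : VonNeumannAlgebra H} {x : H →L[ℂ] H}
    (h : ∀ y ∈ M.commutant, Commute y x) : x ∈ M := by
  rw [← M.commutant_commutant, VonNeumannAlgebra.mem_commutant_iff]
  exact h

theorem commute_of_mem_commutant {M : VonNeumannAlgebra H} {x y : H →L[ℂ] H}
    (hy : y ∈ M.commutant) (hx : x ∈ M) : Commute y x :=
  (VonNeumannAlgebra.mem_commutant_iff.1 hy x hx).symm

theorem rangeProj_mem {M : VonNeumannAlgebra H} {t : H →L[ℂ] H} (ht : t ∈ M) :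
    rangeProj t ∈ M := by
  have key : ∀ y ∈ M.commutant, ∀ x ∈ t.range, y x ∈ t.range := by
    rintro y hy _ ⟨x, rfl⟩
    exact ⟨y x, congr($((commute_of_mem_commutant hy ht).eq) x).symm⟩
  exact mem_of_commute_commutant fun y hy =>
    commute_closureProj (key y hy) (key _ (star_mem hy))

/-- The central support of an element of a von Neumann algebra. -/
theorem exists_central_support {M : VonNeumannAlgebra H} {c : H →L[ℂ] H} (hc : c ∈ M) :
    ∃ z ∈ M, IsStarProjection z ∧ (∀ m ∈ M, Commute m z) ∧ z * c = c ∧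
      ∀ b, (∀ m ∈ M, b * m * c = 0) → b * z = 0 := by
  set N : Submodule ℂ H := Submodule.span ℂ {y | ∃ m ∈ M, ∃ x, y = m (c x)} with hN
  have key : ∀ y : H →L[ℂ] H, (∀ m ∈ M, ∀ x, y (m (c x)) ∈ N) → ∀ x ∈ N, y x ∈ N := by
    intro y h
    suffices N ≤ N.comap y.toLinearMap from this
    rw [hN, Submodule.span_le]
    rintro _ ⟨m, hm, x, rfl⟩
    exact h m hm x
  have k1 : ∀ y ∈ M.commutant, ∀ x ∈ N, y x ∈ N := fun y hy => key y fun m hm x => by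
    have h := congr($((commute_of_mem_commutant hy (mul_mem hm hc)).eq) x)
    exact Submodule.subset_span ⟨m, hm, y x, h⟩
  have k2 : ∀ y ∈ M, ∀ x ∈ N, y x ∈ N := fun y hy => key y fun m hm x =>
    Submodule.subset_span ⟨y * m, mul_mem hy hm, x, rfl⟩
  refine ⟨closureProj N, mem_of_commute_commutant fun y hy =>
    commute_closureProj (k1 y hy) (k1 _ (star_mem hy)), isStarProjection_closureProj N,
    fun m hm => commute_closureProj (k2 m hm) (k2 _ (star_mem hm)), ?_, fun b hb => ?_⟩
  · ext x
    exact closureProj_apply_of_mem (Submodule.subset_span ⟨1, one_mem M, x, rfl⟩)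
  · rw [← zero_mul (closureProj N)]
    refine mul_closureProj_congr ?_
    suffices N ≤ LinearMap.ker b.toLinearMap from fun x hx => this hx
    rw [hN, Submodule.span_le]
    rintro _ ⟨m, hm, x, rfl⟩
    exact congr($(hb m hm) x)

theorem norm_sq_eq_inner_star_mul (t : H →L[ℂ] H) (x : H) :
    ((‖t x‖ : ℂ)) ^ 2 = ⟪(star t * t) x, x⟫_ℂ := by
  rw [mul_apply_eq_comp, ContinuousLinearMap.star_eq_adjoint,
    ContinuousLinearMap.adjoint_inner_left, inner_self_eq_norm_sq_to_K]
  rfl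

theorem star_mul_self_eq_iff {a b : H →L[ℂ] H} :
    star a * a = star b * b ↔ ∀ x, ‖a x‖ = ‖b x‖ := by
  constructor
  · intro h x
    have h1 := norm_sq_eq_inner_star_mul a x
    rw [h, ← norm_sq_eq_inner_star_mul b x] at h1
    norm_cast at h1
    exact (sq_eq_sq₀ (norm_nonneg _) (norm_nonneg _)).1 h1
  · intro h
    ext1 x
    refine congr($((ext_inner_map (star a * a).toLinearMap (star b * b).toLinearMap).1
      fun x => ?_) x)
    have := norm_sq_eq_inner_star_mul a x
    rw [h, norm_sq_eq_inner_star_mul b x] at this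
    exact this.symm

/-- The partial isometry in the polar decomposition of `t`. -/
theorem exists_polar_isometry {M : VonNeumannAlgebra H} {p t : H →L[ℂ] H}
    (hp : IsStarProjection p) (ht : t ∈ M) (htp : t * p = t) (hpt : ∀ x, t x = 0 → p x = 0) :
    ∃ v ∈ M, star v * v = p ∧ ∀ q : H →L[ℂ] H, q * t = t → q * v = v := by
  set s := CFC.abs t with hs
  have hsn : ∀ x, ‖s x‖ = ‖t x‖ := by
    refine star_mul_self_eq_iff.1 ?_
    rw [(CFC.abs_nonneg t).isSelfAdjoint.star_eq, CFC.abs_mul_abs]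
  have hss : star s = s := (CFC.abs_nonneg t).isSelfAdjoint.star_eq
  have hsp : s * p = s := by
    ext x
    have : s (p x - x) = 0 := by
      rw [← norm_eq_zero, hsn, map_sub, ← mul_apply_eq_comp, htp, sub_self, norm_zero]
    simpa [sub_eq_zero] using this
  have hps : p * s = s := by simpa [hss, hp.isSelfAdjoint.star_eq] using congr(star $hsp)
  have he := isStarProjection_rangeProj s
  have hse : s * rangeProj s = s := by
    simpa [hss, he.isSelfAdjoint.star_eq] using congr(star $(rangeProj_mul s))
  have hep : rangeProj s = p := by
    have h1 : p * rangeProj s = rangeProj s :=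
      (mul_rangeProj_congr (hps.trans (one_mul s).symm)).trans (one_mul _)
    rw [← h1]
    ext x
    have h2 : p (rangeProj s x - x) = 0 := by
      refine hpt _ ?_
      rw [← norm_eq_zero, ← hsn, map_sub, ← mul_apply_eq_comp, hse, sub_self, norm_zero]
    simpa [sub_eq_zero] using h2
  let K := s.range.topologicalClosure
  let e : H →ₗ[ℂ] K := s.toLinearMap.codRestrict K
    fun x => s.range.le_topologicalClosure ⟨x, rfl⟩
  have hdense : DenseRange e := by
    intro k
    rw [closure_subtype]
    have : (Subtype.val '' Set.range e) = Set.range s := by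
      rw [← Set.range_comp]; rfl
    rw [this]
    exact k.2
  have hnorm : ∀ x, ‖t.toLinearMap x‖ ≤ 1 * ‖e x‖ := fun x => by
    rw [one_mul]; exact (hsn x).ge
  let w : K →L[ℂ] H := t.toLinearMap.extendOfNorm e
  have hw : ∀ x, w (e x) = t x := LinearMap.extendOfNorm_eq hdense ⟨1, hnorm⟩
  have hwn : ∀ k, ‖w k‖ = ‖k‖ := fun k =>
    hdense.induction_on (p := fun k => ‖w k‖ = ‖k‖) k
      (isClosed_eq (by fun_prop) (by fun_prop)) fun x => by rw [hw]; exact (hsn x).symm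
  let v : H →L[ℂ] H := w ∘L K.orthogonalProjectionOnto
  have hvs : v * s = t := by
    ext x
    have : K.orthogonalProjectionOnto (s x) = e x :=
      Submodule.orthogonalProjectionOnto_mem_subspace_eq_self (e x)
    change w (K.orthogonalProjectionOnto (s x)) = t x
    rw [this, hw]
  have hvp : v * p = v := by
    rw [← hep]
    ext x
    change w (K.orthogonalProjectionOnto (K.starProjection x)) = w (K.orthogonalProjectionOnto x)
    congr 1
    exact Submodule.orthogonalProjectionOnto_mem_subspace_eq_self _
  refine ⟨v, mem_of_commute_commutant fun y hy => ?_, ?_, fun q hq => ?_⟩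
  · have hyt := commute_of_mem_commutant hy ht
    have hyt' := commute_of_mem_commutant (star_mem hy) ht
    have hys : Commute y s := by
      rw [hs]
      have h1 : Commute y (star t * t) := by
        refine Commute.mul_right ?_ hyt
        simpa using hyt'.star_star
      unfold CFC.abs CFC.sqrt
      exact (h1.symm.cfcₙ_nnreal _).symm
    have hyp : Commute y p := by
      rw [← hep]
      refine commute_closureProj ?_ ?_
      · rintro _ ⟨x, rfl⟩
        exact ⟨y x, congr($(hys.eq) x).symm⟩
      · rintro _ ⟨x, rfl⟩
        refine ⟨star y x, congr($((?_ : s * star y = star y * s)) x)⟩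
        simpa [hss] using congr(star $(hys.eq))
    have h1 : (y * v) * rangeProj s = (v * y) * rangeProj s := by
      refine mul_rangeProj_congr ?_
      rw [mul_assoc, hvs, mul_assoc, hys.eq, ← mul_assoc, hvs, hyt.eq]
    rw [hep, mul_assoc, hvp, mul_assoc, hyp.eq, ← mul_assoc, hvp] at h1
    exact h1
  · have h1 : star v * v = star p * p := by
      refine star_mul_self_eq_iff.2 fun x => ?_
      rw [← hep]
      exact hwn _
    rw [h1, hp.isSelfAdjoint.star_eq, hp.isIdempotentElem.eq]
  · have h1 : (q * v) * rangeProj s = v * rangeProj s := by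
      refine mul_rangeProj_congr ?_
      rw [mul_assoc, hvs, hq]
    rwa [hep, mul_assoc, hvp] at h1

end VonNeumann

section VonNeumannSum

open scoped InnerProductSpace

variable {H : Type*} [NormedAddCommGroup H] [InnerProductSpace ℂ H] {ι : Type*}

theorem mul_hasSum {V : ι → H →L[ℂ] H} {v : H →L[ℂ] H} (a : H →L[ℂ] H)
    (hv : ∀ x, HasSum (fun i => V i x) (v x)) (x : H) :
    HasSum (fun i => (a * V i) x) ((a * v) x) :=
  (hv x).mapL a

theorem mul_eq_of_hasSum {V : ι → H →L[ℂ] H} {v a b : H →L[ℂ] H}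
    (hv : ∀ x, HasSum (fun i => V i x) (v x)) (h : ∀ i, a * V i = b * V i) : a * v = b * v := by
  ext x
  refine (mul_hasSum a hv x).unique ?_
  simp_rw [h]
  exact mul_hasSum b hv x

theorem mul_single_of_hasSum {V : ι → H →L[ℂ] H} {v a : H →L[ℂ] H} (i : ι)
    (hv : ∀ x, HasSum (fun i => V i x) (v x)) (h : ∀ j, j ≠ i → a * V j = 0) :
    a * v = a * V i := by
  ext x
  refine (mul_hasSum a hv x).unique ?_
  exact hasSum_single i fun j hj => by rw [h j hj]; rfl

theorem single_mul_of_hasSum {V : ι → H →L[ℂ] H} {v a : H →L[ℂ] H} (i : ι)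
    (hv : ∀ x, HasSum (fun i => V i x) (v x)) (h : ∀ j, j ≠ i → V j * a = 0) :
    v * a = V i * a := by
  ext x
  refine (hv (a x)).unique ?_
  exact hasSum_single i fun j hj => congr($(h j hj) x)

theorem mul_congr_of_hasSum {V : ι → H →L[ℂ] H} {v a b : H →L[ℂ] H}
    (hv : ∀ x, HasSum (fun i => V i x) (v x)) (h : ∀ i, V i * a = V i * b) : v * a = v * b := by
  ext x
  have h' : ∀ i, V i (a x) = V i (b x) := fun i => congr($(h i) x)
  have h2 := hv (a x)
  simp_rw [h'] at h2
  exact h2.unique (hv (b x))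

theorem commute_of_hasSum {V : ι → H →L[ℂ] H} {v y : H →L[ℂ] H}
    (hv : ∀ x, HasSum (fun i => V i x) (v x)) (hy : ∀ i, Commute y (V i)) : Commute y v := by
  ext x
  have h := (hv x).mapL y
  have h' : ∀ i, y (V i x) = V i (y x) := fun i => congr($((hy i).eq) x)
  simp_rw [h'] at h
  exact h.unique (hv (y x))

variable [CompleteSpace H] {M : VonNeumannAlgebra H}

theorem mem_of_hasSum {V : ι → H →L[ℂ] H} {v : H →L[ℂ] H} (hV : ∀ i, V i ∈ M)
    (hv : ∀ x, HasSum (fun i => V i x) (v x)) : v ∈ M :=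
  mem_of_commute_commutant fun _ hy =>
    commute_of_hasSum hv fun i => commute_of_mem_commutant hy (hV i)

theorem inner_apply_apply_eq (a b : H →L[ℂ] H) (x y : H) :
    ⟪a x, b y⟫_ℂ = ⟪(star b * a) x, y⟫_ℂ := by
  rw [mul_apply_eq_comp, ContinuousLinearMap.star_eq_adjoint,
    ContinuousLinearMap.adjoint_inner_left]

theorem summable_of_orthogonal_range {V : ι → H →L[ℂ] H}
    (horth : Pairwise fun i j => star (V i) * V j = 0) {x : H}
    (hx : Summable fun i => ‖V i x‖ ^ 2) : Summable fun i => V i x := by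
  have hfam : OrthogonalFamily ℂ (fun i => (V i).range) fun i => (V i).range.subtypeₗᵢ := by
    rintro i j hij ⟨_, a, rfl⟩ ⟨_, b, rfl⟩
    change ⟪V i a, V j b⟫_ℂ = 0
    rw [inner_apply_apply_eq, horth hij.symm]
    simp
  exact (hfam.summable_iff_norm_sq_summable fun i => ⟨V i x, x, rfl⟩).2 hx

/-- Operators with orthogonal ranges can be summed strongly when the sum of the `star vᵢ * vᵢ`
exists. -/
theorem exists_hasSum_of_orthogonal_range {V : ι → H →L[ℂ] H} {p : H →L[ℂ] H}
    (horth : Pairwise fun i j => star (V i) * V j = 0)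
    (hp : ∀ x, HasSum (fun i => (star (V i) * V i) x) (p x)) :
    ∃ v : H →L[ℂ] H, (∀ x, HasSum (fun i => V i x) (v x)) ∧ star v * v = p := by
  have hinner : ∀ x y, HasSum (fun i => ⟪V i x, V i y⟫_ℂ) ⟪p x, y⟫_ℂ := by
    intro x y
    simp_rw [inner_apply_apply_eq]
    exact (hp x).map (innerₛₗ ℂ |>.flip y).toAddMonoidHom (by
      change Continuous fun z => ⟪z, y⟫_ℂ
      fun_prop)
  have hsum : ∀ x, Summable fun i => V i x := fun x => by
    refine summable_of_orthogonal_range horth ?_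
    have := (Complex.reCLM.hasSum (hinner x x)).summable
    refine this.congr fun i => ?_
    simp only [inner_self_eq_norm_sq_to_K]
    norm_cast
  have hs := fun x => (hsum x).hasSum
  have hnorm : ∀ x y, ⟪∑' i, V i x, ∑' i, V i y⟫_ℂ = ⟪p x, y⟫_ℂ := by
    intro x y
    have h1 : HasSum (fun i => ⟪∑' i, V i x, V i y⟫_ℂ) ⟪∑' i, V i x, ∑' i, V i y⟫_ℂ :=
      (hs y).mapL (innerSL ℂ (∑' i, V i x))
    refine h1.unique ?_
    convert hinner x y using 2 with i
    have h2 : HasSum (fun j => ⟪V i y, V j x⟫_ℂ) ⟪V i y, ∑' i, V i x⟫_ℂ :=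
      (hs x).mapL (innerSL ℂ (V i y))
    rw [← inner_conj_symm, ← inner_conj_symm (V i x)]
    congr 1
    refine h2.unique (hasSum_single i fun j hj => ?_)
    rw [inner_apply_apply_eq, horth hj]
    simp
  let v₀ : H →ₗ[ℂ] H :=
    { toFun := fun x => ∑' i, V i x
      map_add' := fun x y => by
        simpa using (hsum x).tsum_add (hsum y)
      map_smul' := fun c x => by
        simpa using (hsum x).tsum_const_smul c }
  have hbd : ∀ x, ‖v₀ x‖ ≤ Real.sqrt ‖p‖ * ‖x‖ := by
    intro x
    have h1 : ((‖v₀ x‖ ^ 2 : ℝ) : ℂ) = ⟪p x, x⟫_ℂ := by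
      rw [← hnorm x x, inner_self_eq_norm_sq_to_K]
      push_cast
      rfl
    have h2 : ‖v₀ x‖ ^ 2 ≤ ‖p‖ * ‖x‖ ^ 2 := by
      have h3 := norm_inner_le_norm (𝕜 := ℂ) (p x) x
      rw [← h1, Complex.norm_real, Real.norm_of_nonneg (by positivity)] at h3
      have h4 := p.le_opNorm x
      nlinarith [norm_nonneg x]
    rw [← Real.sqrt_sq (norm_nonneg x), ← Real.sqrt_mul (norm_nonneg p)]
    exact Real.le_sqrt_of_sq_le h2
  let v : H →L[ℂ] H := v₀.mkContinuous _ hbd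
  refine ⟨v, hs, ?_⟩
  ext1 x
  refine ext_inner_right ℂ fun y => ?_
  rw [← inner_apply_apply_eq]
  exact hnorm x y

/-- An orthogonal family of projections has a strong sum, which is a projection. -/
theorem exists_hasSum_projection {P : ι → H →L[ℂ] H} (hP : ∀ i, IsStarProjection (P i))
    (horth : Pairwise fun i j => P i * P j = 0) :
    ∃ p : H →L[ℂ] H, IsStarProjection p ∧ ∀ x, HasSum (fun i => P i x) (p x) := by
  have hself : ∀ i, star (P i) = P i := fun i => (hP i).isSelfAdjoint.star_eq
  have hsum : ∀ x, Summable fun i => P i x := fun x => by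
    refine summable_of_orthogonal_range (by simpa only [hself] using horth) ?_
    refine summable_of_sum_le (c := ‖x‖ ^ 2) (fun _ => by positivity) fun s => ?_
    have hs : IsStarProjection (∑ i ∈ s, P i) := by
      constructor
      · rw [IsIdempotentElem, Finset.sum_mul_sum]
        refine Finset.sum_congr rfl fun i hi => ?_
        rw [Finset.sum_eq_single i (fun j _ hj => horth hj.symm) (by simp [hi]),
          (hP i).isIdempotentElem.eq]
      · simp [IsSelfAdjoint, hself]
    have h1 : ∀ Q : H →L[ℂ] H, IsStarProjection Q → ((‖Q x‖ ^ 2 : ℝ) : ℂ) = ⟪Q x, x⟫_ℂ := by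
      intro Q hQ
      rw [Complex.ofReal_pow, norm_sq_eq_inner_star_mul, hQ.isSelfAdjoint.star_eq,
        hQ.isIdempotentElem.eq]
    have h2 : ∑ i ∈ s, ‖P i x‖ ^ 2 = ‖(∑ i ∈ s, P i) x‖ ^ 2 := by
      have : ((∑ i ∈ s, ‖P i x‖ ^ 2 : ℝ) : ℂ) = ((‖(∑ i ∈ s, P i) x‖ ^ 2 : ℝ) : ℂ) := by
        rw [h1 _ hs, Complex.ofReal_sum, Finset.sum_congr rfl fun i _ => h1 _ (hP i),
          sum_apply, sum_inner]
      exact_mod_cast this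
    rw [h2]
    have h3 : ‖(∑ i ∈ s, P i) x‖ ≤ ‖x‖ := by
      have h4 := norm_inner_le_norm (𝕜 := ℂ) ((∑ i ∈ s, P i) x) x
      rw [← h1 _ hs, Complex.norm_real, Real.norm_of_nonneg (by positivity)] at h4
      nlinarith [norm_nonneg x, norm_nonneg ((∑ i ∈ s, P i) x)]
    gcongr
  let N : Submodule ℂ H := ⨆ i, (P i).range
  refine ⟨closureProj N, isStarProjection_closureProj N, fun x => ?_⟩
  have hmem : ∑' i, P i x ∈ N.topologicalClosure :=
    (Submodule.isClosed_topologicalClosure N).mem_of_tendsto (hsum x).hasSum <|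
      Filter.Eventually.of_forall fun s => sum_mem fun i _ =>
        N.le_topologicalClosure (Submodule.mem_iSup_of_mem i ⟨x, rfl⟩)
  convert (hsum x).hasSum using 1
  refine Submodule.eq_starProjection_of_mem_orthogonal hmem ?_
  rw [Submodule.orthogonal_closure, ← Submodule.iInf_orthogonal, Submodule.mem_iInf]
  intro i
  rw [ContinuousLinearMap.orthogonal_range, ← ContinuousLinearMap.star_eq_adjoint, hself,
    LinearMap.mem_ker]
  have h5 : HasSum (fun j => P i (P j x)) (P i (∑' j, P j x)) := (hsum x).hasSum.mapL (P i)
  have h6 := h5.unique (hasSum_single i fun j hj => congr($(horth hj.symm) x))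
  have h7 : P i (P i x) = P i x := congr($((hP i).isIdempotentElem.eq) x)
  change P i (x - ∑' j, P j x) = 0
  rw [map_sub, h6]
  exact sub_eq_zero.2 h7.symm

end VonNeumannSum

section Comparison

variable {H : Type*} [NormedAddCommGroup H] [InnerProductSpace ℂ H] [CompleteSpace H]
  {M : VonNeumannAlgebra H}

theorem mul_eq_self_of_star_mul_self {v p : H →L[ℂ] H} (hp : IsStarProjection p)
    (h : star v * v = p) : v * p = v := by
  have h1 : star (v * p - v) * (v * p - v) = 0 := by
    have hs := hp.isSelfAdjoint.star_eq
    have hi := hp.isIdempotentElem.eq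
    simp only [star_sub, star_mul, hs, sub_mul, mul_sub]
    have e1 : p * star v * (v * p) = p := by
      rw [mul_assoc, ← mul_assoc (star v), h, hi, hi]
    rw [e1, mul_assoc p, h, ← mul_assoc (star v), h, hi, sub_self]
  exact sub_eq_zero.1 (CStarRing.star_mul_self_eq_zero_iff _ |>.1 h1)

theorem isStarProjection_mul_star {v : H →L[ℂ] H} (h : v * star v * v = v) :
    IsStarProjection (v * star v) where
  isIdempotentElem := by rw [IsIdempotentElem, ← mul_assoc, h]
  isSelfAdjoint := .mul_star_self v

theorem isStarProjection_star_mul {v : H →L[ℂ] H} (h : v * star v * v = v) :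
    IsStarProjection (star v * v) where
  isIdempotentElem := by rw [IsIdempotentElem, mul_assoc, ← mul_assoc v, h]
  isSelfAdjoint := .star_mul_self v

/-- Every nonzero operator in a von Neumann algebra dominates a nonzero partial isometry. -/
theorem exists_partial_isometry_of_ne_zero {t : H →L[ℂ] H} (ht : t ∈ M) (h0 : t ≠ 0) :
    ∃ w ∈ M, w ≠ 0 ∧ w * star w * w = w ∧ (∀ q, q * t = t → q * w = w) ∧
      ∀ a, t * a = t → w * a = w := by
  set p := rangeProj (star t) with hpdef
  have hp : IsStarProjection p := isStarProjection_rangeProj _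
  have hpt : p * star t = star t := rangeProj_mul _
  have htp : t * p = t := by simpa [hp.isSelfAdjoint.star_eq] using congr(star $hpt)
  have hker : ∀ x, t x = 0 → p x = 0 := by
    intro x hx
    refine (Submodule.starProjection_apply_eq_zero_iff _).2 ?_
    rw [Submodule.orthogonal_closure, ContinuousLinearMap.orthogonal_range,
      ← ContinuousLinearMap.star_eq_adjoint, star_star]
    exact hx
  obtain ⟨w, hw, hwp, hwq⟩ := exists_polar_isometry hp ht htp hker
  have hwp' := mul_eq_self_of_star_mul_self hp hwp
  refine ⟨w, hw, ?_, by rw [mul_assoc, hwp, hwp'], hwq, fun a ha => ?_⟩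
  · rintro rfl
    rw [mul_zero] at hwp
    rw [← hwp, mul_zero] at htp
    exact h0 htp.symm
  · have h1 : star a * p = 1 * p := mul_rangeProj_congr (by
      rw [one_mul, ← star_mul, ha])
    have h2 : p * a = p := by
      simpa [hp.isSelfAdjoint.star_eq] using congr(star $h1)
    rw [← hwp', mul_assoc, h2]

theorem exists_maximal_partial_isometry {e f : H →L[ℂ] H} (he : IsStarProjection e) (heM : e ∈ M)
    (hf : IsStarProjection f) (hfM : f ∈ M) :
    ∃ v ∈ M, v * star v * v = v ∧ v * e = v ∧ f * v = v ∧
      ∀ m ∈ M, (f - v * star v) * m * (e - star v * v) = 0 := by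
  let S : Set (Set (H →L[ℂ] H)) :=
    {X | (∀ w ∈ X, w ∈ M ∧ w * star w * w = w ∧ w * e = w ∧ f * w = w) ∧
      X.Pairwise fun a b => star a * b = 0 ∧ a * star b = 0}
  obtain ⟨X, ⟨hX, hXp⟩, hmax⟩ : ∃ X, Maximal (· ∈ S) X := by
    refine zorn_subset S fun c hc hchain => ⟨⋃₀ c, ⟨?_, ?_⟩, fun s => Set.subset_sUnion_of_mem⟩
    · rintro w ⟨s, hs, hw⟩
      exact (hc hs).1 w hw
    · exact (Set.pairwise_sUnion hchain.directedOn).2 fun s hs => (hc hs).2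
  have hXp' : ∀ i j : X, j ≠ i → star (i : H →L[ℂ] H) * j = 0 ∧ (i : H →L[ℂ] H) * star j.1 = 0 :=
    fun i j hij => hXp i.2 j.2 fun h => hij (Subtype.ext h).symm
  obtain ⟨s, hs, hsum⟩ := exists_hasSum_projection (P := fun i : X => star i.1 * i.1)
    (fun i => isStarProjection_star_mul (hX i i.2).2.1) (fun i j hij => by
      change star i.1 * i.1 * (star j.1 * j.1) = 0
      rw [mul_assoc, ← mul_assoc i.1, (hXp' i j hij.symm).2, zero_mul, mul_zero])
  obtain ⟨v, hv, hvs⟩ := exists_hasSum_of_orthogonal_range (V := fun i : X => i.1)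
    (fun i j hij => (hXp' i j hij.symm).1) hsum
  have hvM : v ∈ M := mem_of_hasSum (V := fun i : X => i.1) (fun i => (hX i i.2).1) hv
  have hvv : v * star v * v = v := by
    rw [mul_assoc, hvs, mul_eq_self_of_star_mul_self hs hvs]
  have hve : v * e = v := by
    rw [mul_congr_of_hasSum hv (b := 1) fun i => by rw [(hX i i.2).2.2.1, mul_one], mul_one]
  have hfv : f * v = v := by
    rw [mul_eq_of_hasSum hv (b := 1) fun i => by rw [(hX i i.2).2.2.2, one_mul], one_mul]
  refine ⟨v, hvM, hvv, hve, hfv, fun m hm => ?_⟩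
  by_contra hne
  have hf' : IsStarProjection (f - v * star v) :=
    (isStarProjection_mul_star hvv).sub_of_mul_eq_right hf (by rw [← mul_assoc, hfv])
  have he' : IsStarProjection (e - star v * v) :=
    (isStarProjection_star_mul hvv).sub_of_mul_eq_left he (by rw [mul_assoc, hve])
  obtain ⟨w, hw, hw0, hww, hwl, hwr⟩ := exists_partial_isometry_of_ne_zero
    (mul_mem (mul_mem (sub_mem hfM (mul_mem hvM (star_mem hvM))) hm)
      (sub_mem heM (mul_mem (star_mem hvM) hvM))) hne
  have hfw := hwl (f - v * star v) (by simp only [← mul_assoc, hf'.isIdempotentElem.eq])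
  have hwe := hwr (e - star v * v) (by rw [mul_assoc, he'.isIdempotentElem.eq])
  have hffw : f * w = w := by
    rw [← hfw, ← mul_assoc, mul_sub, hf.isIdempotentElem.eq, ← mul_assoc, hfv]
  have hwee : w * e = w := by
    rw [← hwe, mul_assoc, sub_mul, he.isIdempotentElem.eq, mul_assoc, hve]
  have h1 : ∀ i : X, star i.1 * (f - v * star v) = 0 := by
    intro i
    have a1 : star i.1 * f = star i.1 := by
      simpa [hf.isSelfAdjoint.star_eq] using congr(star $((hX i i.2).2.2.2))
    have a2 : star i.1 * v = star i.1 * i.1 :=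
      mul_single_of_hasSum i hv fun j hj => (hXp' i j hj).1
    have a3 : v * (star i.1 * i.1) = i.1 * (star i.1 * i.1) :=
      single_mul_of_hasSum i hv fun j hj => by
        rw [← mul_assoc, (hXp' j i hj.symm).2, zero_mul]
    rw [← mul_assoc i.1, (hX i i.2).2.1] at a3
    have a4 : star i.1 * i.1 * star v = star i.1 := by
      simpa [mul_assoc] using congr(star $a3)
    rw [mul_sub, a1, ← mul_assoc, a2, a4, sub_self]
  have h2 : ∀ i : X, i.1 * (e - star v * v) = 0 := by
    intro i
    have a2 : v * star i.1 = i.1 * star i.1 :=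
      single_mul_of_hasSum i hv fun j hj => (hXp' j i hj.symm).2
    have a3 : i.1 * star v = i.1 * star i.1 := by simpa using congr(star $a2)
    have a4 : i.1 * star i.1 * v = i.1 * star i.1 * i.1 :=
      mul_single_of_hasSum i hv fun j hj => by
        rw [mul_assoc, (hXp' i j hj).1, mul_zero]
    rw [mul_sub, (hX i i.2).2.2.1, ← mul_assoc, a3, a4, (hX i i.2).2.1, sub_self]
  have h3 : ∀ i : X, star i.1 * w = 0 := fun i => by rw [← hfw, ← mul_assoc, h1, zero_mul]
  have h4 : ∀ i : X, i.1 * star w = 0 := fun i => by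
    rw [← hwe, star_mul, he'.isSelfAdjoint.star_eq, ← mul_assoc, h2, zero_mul]
  have hwX : w ∉ X := fun h => hw0 <|
    (CStarRing.star_mul_self_eq_zero_iff w).1 (h3 ⟨w, h⟩)
  refine hwX (hmax (y := insert w X) ⟨?_, ?_⟩ (Set.subset_insert w X) (Set.mem_insert w X))
  · rintro u (rfl | hu)
    · exact ⟨hw, hww, hwee, hffw⟩
    · exact hX u hu
  · refine (Set.pairwise_insert_of_notMem hwX).2
      ⟨hXp, fun b hb => ⟨⟨?_, ?_⟩, h3 ⟨b, hb⟩, h4 ⟨b, hb⟩⟩⟩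
    · simpa using congr(star $(h3 ⟨b, hb⟩))
    · simpa using congr(star $(h4 ⟨b, hb⟩))

/-- Murray–von Neumann subequivalence of projections. -/
def SubEquiv (M : VonNeumannAlgebra H) (p q : H →L[ℂ] H) : Prop :=
  ∃ v ∈ M, star v * v = p ∧ q * v = v

/-- The Cantor–Schröder–Bernstein theorem for projections. -/
theorem SubEquiv.antisymm {p q : H →L[ℂ] H} (hp : IsStarProjection p) (hq : IsStarProjection q)
    (hpM : p ∈ M) (hpq : SubEquiv M p q) (hqp : SubEquiv M q p) :
    ∃ v ∈ M, star v * v = p ∧ v * star v = q := by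
  obtain ⟨v, hv, hvp, hqv⟩ := hpq
  obtain ⟨w, hw, hwq, hpw⟩ := hqp
  have hps := hp.isSelfAdjoint.star_eq
  have hpi := hp.isIdempotentElem.eq
  have hvp' := mul_eq_self_of_star_mul_self hp hvp
  have hwq' := mul_eq_self_of_star_mul_self hq hwq
  set φ := w * v with hφ
  have hwww : w * star w * w = w := by rw [mul_assoc, hwq, hwq']
  have hf := isStarProjection_mul_star hwww
  set f := w * star w with hfdef
  have hpf : p * f = f := by rw [hfdef, ← mul_assoc, hpw]
  have hd : IsStarProjection (p - f) := hf.sub_of_mul_eq_right hp hpf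
  set d := p - f with hddef
  have hφM : φ ∈ M := mul_mem hw hv
  have hφφ : star φ * φ = p := by
    rw [hφ, star_mul, mul_assoc, ← mul_assoc (star w), hwq, hqv, hvp]
  have hφp : φ * p = φ := mul_eq_self_of_star_mul_self hp hφφ
  have hpφ : p * φ = φ := by rw [hφ, ← mul_assoc, hpw]
  have hfφ : f * φ = φ := by rw [hφ, ← mul_assoc, hwww]
  have hdφ : d * φ = 0 := by rw [hddef, sub_mul, hpφ, hfφ, sub_self]
  have hpd : p * d = d := by rw [hddef, mul_sub, hpi, hpf]
  have hdM : d ∈ M := sub_mem hpM (mul_mem hw (star_mem hw))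
  have hpn : ∀ n : ℕ, p * (φ ^ n * d) = φ ^ n * d := by
    intro n
    cases n with
    | zero => simpa using hpd
    | succ n => rw [pow_succ', ← mul_assoc, ← mul_assoc, hpφ]
  have hcancel : ∀ n k : ℕ, star (φ ^ n * d) * (φ ^ (n + k) * d) = d * (φ ^ k * d) := by
    intro n k
    induction n with
    | zero => simp [hd.isSelfAdjoint.star_eq]
    | succ n ih =>
      rw [← ih, pow_succ', mul_assoc, star_mul, add_right_comm, pow_succ' φ (n + k), mul_assoc,
        mul_assoc φ, ← mul_assoc (star φ), hφφ, hpn]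
  have hdn : ∀ n : ℕ, n ≠ 0 → d * (φ ^ n * d) = 0 := by
    intro n hn
    obtain ⟨k, rfl⟩ := Nat.exists_eq_succ_of_ne_zero hn
    rw [pow_succ', mul_assoc, ← mul_assoc, hdφ, zero_mul]
  have horth : ∀ i j : ℕ, i ≠ j → star (φ ^ i * d) * (φ ^ j * d) = 0 := by
    have key : ∀ i j : ℕ, i < j → star (φ ^ i * d) * (φ ^ j * d) = 0 := by
      intro i j hij
      obtain ⟨k, rfl⟩ := Nat.exists_eq_add_of_lt hij
      rw [add_assoc, hcancel, hdn _ (by omega)]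
    intro i j hij
    rcases lt_or_gt_of_ne hij with h | h
    · exact key i j h
    · have := congr(star $(key j i h))
      simpa only [star_mul (star (φ ^ j * d)), star_star, star_zero] using this
  have hself : ∀ n : ℕ, star (φ ^ n * d) * (φ ^ n * d) = d := fun n => by
    have := hcancel n 0
    rwa [add_zero, pow_zero, one_mul, hd.isIdempotentElem.eq] at this
  have hpi' : ∀ n : ℕ, (φ ^ n * d) * star (φ ^ n * d) * (φ ^ n * d) = φ ^ n * d := fun n => by
    rw [mul_assoc, hself, mul_assoc, hd.isIdempotentElem.eq]
  obtain ⟨s, hs, hsum⟩ := exists_hasSum_projection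
    (P := fun n : ℕ => (φ ^ n * d) * star (φ ^ n * d))
    (fun n => isStarProjection_mul_star (hpi' n)) (fun i j hij => by
      change φ ^ i * d * star (φ ^ i * d) * (φ ^ j * d * star (φ ^ j * d)) = 0
      rw [mul_assoc, ← mul_assoc (star _), horth i j hij, zero_mul, mul_zero])
  have hsM : s ∈ M := mem_of_hasSum (fun n =>
    mul_mem (mul_mem (pow_mem hφM n) hdM) (star_mem (mul_mem (pow_mem hφM n) hdM))) hsum
  have hps' : p * s = s := by
    rw [mul_eq_of_hasSum hsum (b := 1) fun n => by rw [← mul_assoc, hpn, one_mul], one_mul]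
  have hss := hs.isSelfAdjoint.star_eq
  have hsp : s * p = s := by simpa [hss, hps] using congr(star $hps')
  have hshift : φ * s * star φ = s - d := by
    ext x
    have h1 := mul_hasSum φ hsum (star φ x)
    have h2 := (hasSum_nat_add_iff' 1).2 (hsum x)
    have h3 : ∀ n : ℕ, (φ * ((φ ^ n * d) * star (φ ^ n * d))) (star φ x) =
        ((φ ^ (n + 1) * d) * star (φ ^ (n + 1) * d)) x := by
      intro n
      change (φ * ((φ ^ n * d) * star (φ ^ n * d)) * star φ) x = _
      congr 1
      rw [pow_succ', mul_assoc φ (φ ^ n) d, star_mul φ (φ ^ n * d)]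
      simp only [mul_assoc]
    simp_rw [h3] at h1
    have h4 := h1.unique h2
    rw [Finset.sum_range_one, pow_zero, one_mul, hd.isSelfAdjoint.star_eq,
      hd.isIdempotentElem.eq] at h4
    exact h4
  have hsd : s * d = d := by
    have h := mul_single_of_hasSum (a := d) 0 hsum (fun n hn => by
      rw [← mul_assoc, hdn n hn, zero_mul])
    have h' : d * s = d := by
      simpa [hd.isSelfAdjoint.star_eq, ← mul_assoc, hd.isIdempotentElem.eq] using h
    simpa [hd.isSelfAdjoint.star_eq, hss] using congr(star $h')
  have hφs : φ * s = (s - d) * φ := by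
    rw [← hshift, mul_assoc (φ * s) (star φ) φ, hφφ, mul_assoc φ s p, hsp]
  set u := φ * s + (p - s) with hu
  have hcross : (p - s) * (φ * s) = 0 := by
    rw [hφs, ← mul_assoc, mul_sub, sub_mul, sub_mul, hps', hs.isIdempotentElem.eq,
      sub_self, zero_mul, sub_mul p s d, hpd, hsd, sub_self, zero_mul, sub_self]
  have hcross' : star (φ * s) * (p - s) = 0 := by
    simpa [hss, hps, mul_assoc] using congr(star $hcross)
  have hps2 : IsStarProjection (p - s) := hs.sub_of_mul_eq_right hp hps'
  have huu : star u * u = p := by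
    rw [hu, star_add, add_mul, mul_add, mul_add, hcross', hps2.isSelfAdjoint.star_eq, hcross,
      hps2.isIdempotentElem.eq, star_mul, hss, mul_assoc, ← mul_assoc (star φ), hφφ, hps',
      hs.isIdempotentElem.eq]
    abel
  have huu' : u * star u = f := by
    have a1 : φ * s * (p - s) = 0 := by
      rw [mul_assoc, mul_sub, hsp, hs.isIdempotentElem.eq, sub_self, mul_zero]
    have a2 : (p - s) * star (φ * s) = 0 := by
      simpa [hss, hps, mul_assoc] using congr(star $a1)
    have a3 : φ * s * star (φ * s) = s - d := by
      rw [star_mul, hss, mul_assoc, ← mul_assoc s, hs.isIdempotentElem.eq, ← mul_assoc, hshift]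
    rw [hu, star_add, add_mul, mul_add, mul_add, hps2.isSelfAdjoint.star_eq, a1, a2, a3,
      hps2.isIdempotentElem.eq, hddef]
    abel
  have hfu : f * u = u := by
    rw [← huu', mul_assoc, huu]
    rw [hu, add_mul, sub_mul, mul_assoc, hsp, hpi]
  refine ⟨star w * u, mul_mem (star_mem hw) (add_mem (mul_mem hφM hsM) (sub_mem hpM hsM)), ?_, ?_⟩
  · rw [star_mul, star_star, mul_assoc, ← mul_assoc w, ← hfdef, hfu, huu]
  · rw [star_mul, star_star, mul_assoc, ← mul_assoc u, huu', hfdef, hwww, hwq]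

end Comparison

section Exhaustion

variable {H : Type*} [NormedAddCommGroup H] [InnerProductSpace ℂ H] [CompleteSpace H]
  {M : VonNeumannAlgebra H}

/-- An increasing sequence of projections of `M`, starting at zero. -/
structure IsProjectionSeq (M : VonNeumannAlgebra H) (p : ℕ → H →L[ℂ] H) : Prop where
  isStarProjection : ∀ n, IsStarProjection (p n)
  mem : ∀ n, p n ∈ M
  zero : p 0 = 0
  mul_succ : ∀ n, p n * p (n + 1) = p n

namespace IsProjectionSeq

variable {p : ℕ → H →L[ℂ] H} {P : H →L[ℂ] H}

theorem mul_of_le (h : IsProjectionSeq M p) {m n : ℕ} (hmn : m ≤ n) : p m * p n = p m := by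
  induction n, hmn using Nat.le_induction with
  | base => exact (h.isStarProjection m).isIdempotentElem
  | succ n _ ih => rw [← ih, mul_assoc, h.mul_succ]

theorem mul_of_ge (h : IsProjectionSeq M p) {m n : ℕ} (hmn : m ≤ n) : p n * p m = p m := by
  simpa [(h.isStarProjection _).isSelfAdjoint.star_eq] using congr(star $(h.mul_of_le hmn))

theorem isStarProjection_sub (h : IsProjectionSeq M p) (n : ℕ) :
    IsStarProjection (p (n + 1) - p n) :=
  (h.isStarProjection n).sub_of_mul_eq_left (h.isStarProjection (n + 1)) (h.mul_succ n)

theorem sub_mul_sub (h : IsProjectionSeq M p) {m n : ℕ} (hmn : m ≠ n) :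
    (p (m + 1) - p m) * (p (n + 1) - p n) = 0 := by
  rcases lt_or_gt_of_ne hmn with h' | h'
  · simp only [sub_mul, mul_sub, h.mul_of_le (show m + 1 ≤ n + 1 by omega),
      h.mul_of_le (show m + 1 ≤ n by omega), h.mul_of_le (show m ≤ n + 1 by omega),
      h.mul_of_le (show m ≤ n by omega), sub_self]
  · simp only [sub_mul, mul_sub, h.mul_of_ge (show n + 1 ≤ m + 1 by omega),
      h.mul_of_ge (show n + 1 ≤ m by omega), h.mul_of_ge (show n ≤ m + 1 by omega),
      h.mul_of_ge (show n ≤ m by omega), sub_self]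

theorem sub_mul_of_le (h : IsProjectionSeq M p) {m n : ℕ} (hmn : m ≤ n) :
    (p (m + 1) - p m) * p (n + 1) = p (m + 1) - p m := by
  rw [sub_mul, h.mul_of_le (by omega), h.mul_of_le (by omega)]

theorem limit_mul_sub (h : IsProjectionSeq M p) (hP : IsStarProjection P)
    (hsum : ∀ x, HasSum (fun n => (p (n + 1) - p n) x) (P x)) (n : ℕ) :
    P * (p (n + 1) - p n) = p (n + 1) - p n := by
  have h1 := mul_single_of_hasSum (a := p (n + 1) - p n) n hsum
    fun m hm => h.sub_mul_sub hm.symm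
  rw [(h.isStarProjection_sub n).isIdempotentElem.eq] at h1
  have h2 := congr(star $h1)
  rwa [star_mul, (h.isStarProjection_sub n).isSelfAdjoint.star_eq,
    hP.isSelfAdjoint.star_eq] at h2

end IsProjectionSeq

/-- An increasing sequence of projections of `M`, starting at zero, with strong limit `P`. -/
structure IsExhaustion (M : VonNeumannAlgebra H) (p : ℕ → H →L[ℂ] H) (P : H →L[ℂ] H) : Prop
    extends IsProjectionSeq M p where
  isStarProjection_limit : IsStarProjection P
  hasSum : ∀ x, HasSum (fun n => (p (n + 1) - p n) x) (P x)

theorem IsProjectionSeq.isExhaustion {p : ℕ → H →L[ℂ] H} {P : H →L[ℂ] H}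
    (h : IsProjectionSeq M p) (hP : IsStarProjection P) (hPp : ∀ n, P * p n = p n)
    (hlim : ∀ a, (∀ n, a * p n = 0) → a * P = 0) : IsExhaustion M p P := by
  obtain ⟨s, hs, hsum⟩ := exists_hasSum_projection (fun n => h.isStarProjection_sub n)
    fun m n hmn => h.sub_mul_sub hmn
  have hsp : ∀ n, s * p n = p n := by
    intro n
    induction n with
    | zero => rw [h.zero, mul_zero]
    | succ n ih => rw [← add_sub_cancel (p n) (p (n + 1)), mul_add, ih, h.limit_mul_sub hs hsum]
  have h1 := hlim (s - 1) fun n => by rw [sub_mul, hsp, one_mul, sub_self]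
  rw [sub_mul, one_mul, sub_eq_zero] at h1
  have h2 : P * s = 1 * s := mul_eq_of_hasSum hsum fun n => by
    rw [mul_sub, hPp, hPp, one_mul]
  have h3 := congr(star $h2)
  rw [one_mul, star_mul, hs.isSelfAdjoint.star_eq, hP.isSelfAdjoint.star_eq, h1] at h3
  exact ⟨h, hP, h3 ▸ hsum⟩

namespace IsExhaustion

variable {p : ℕ → H →L[ℂ] H} {P : H →L[ℂ] H}

theorem subEquiv_of_extension (h : IsExhaustion M p P) {q : H →L[ℂ] H}
    (hext : ∀ n, ∀ v ∈ M, star v * v = p n → q * v = v →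
      ∃ v', (v' ∈ M ∧ star v' * v' = p (n + 1) ∧ q * v' = v') ∧ v' * p n = v) :
    SubEquiv M P q := by
  have hBs : ∀ n, star (p (n + 1) - p n) = p (n + 1) - p n :=
    fun n => (h.isStarProjection_sub n).isSelfAdjoint.star_eq
  have hBi : ∀ n, (p (n + 1) - p n) * (p (n + 1) - p n) = p (n + 1) - p n :=
    fun n => (h.isStarProjection_sub n).isIdempotentElem.eq
  choose! F hF using hext
  obtain ⟨V, hVM, hVV, hqV, hVp⟩ : ∃ V : ℕ → H →L[ℂ] H, (∀ n, V n ∈ M) ∧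
      (∀ n, star (V n) * V n = p n) ∧ (∀ n, q * V n = V n) ∧ ∀ n, V (n + 1) * p n = V n := by
    let V : ℕ → H →L[ℂ] H := fun n => Nat.rec 0 F n
    have hV : ∀ n, V n ∈ M ∧ star (V n) * V n = p n ∧ q * V n = V n := by
      intro n
      induction n with
      | zero => exact ⟨zero_mem M, by simp [V, h.zero], by simp [V]⟩
      | succ n ih => exact (hF n _ ih.1 ih.2.1 ih.2.2).1
    exact ⟨V, fun n => (hV n).1, fun n => (hV n).2.1, fun n => (hV n).2.2,
      fun n => (hF n _ (hV n).1 (hV n).2.1 (hV n).2.2).2⟩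
  have hVB : ∀ m n, m ≤ n →
      V (n + 1) * (p (m + 1) - p m) = V (m + 1) * (p (m + 1) - p m) := by
    intro m n hmn
    induction n, hmn using Nat.le_induction with
    | base => rfl
    | succ n hmn ih =>
      rw [← ih, ← hVp (n + 1), mul_assoc]
      congr 1
      have := congr(star $(h.sub_mul_of_le hmn))
      rw [star_mul, hBs, (h.isStarProjection _).isSelfAdjoint.star_eq] at this
      exact this.symm
  have hcross : ∀ m n, m ≤ n → star (V (m + 1) * (p (m + 1) - p m)) *
      (V (n + 1) * (p (n + 1) - p n)) = (p (m + 1) - p m) * (p (n + 1) - p n) := by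
    intro m n hmn
    rw [← hVB m n hmn, star_mul, hBs, mul_assoc, ← mul_assoc (star (V (n + 1))), hVV,
      ← mul_assoc, h.sub_mul_of_le hmn]
  have horth : Pairwise fun m n => star (V (m + 1) * (p (m + 1) - p m)) *
      (V (n + 1) * (p (n + 1) - p n)) = 0 := by
    intro m n hmn
    rcases le_total m n with h' | h'
    · rw [hcross m n h', h.sub_mul_sub hmn]
    · have := congr(star $(hcross n m h'))
      rw [h.sub_mul_sub hmn.symm, star_mul (star _), star_star, star_zero] at this
      exact this
  obtain ⟨v, hv, hvP⟩ := exists_hasSum_of_orthogonal_range horth (p := P) (by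
    simp_rw [fun n => hcross n n le_rfl, hBi]
    exact h.hasSum)
  refine ⟨v, mem_of_hasSum (fun n => mul_mem (hVM _) (sub_mem (h.mem _) (h.mem _))) hv, hvP, ?_⟩
  rw [mul_eq_of_hasSum hv (b := 1) fun n => by rw [← mul_assoc, hqV, one_mul], one_mul]

theorem exists_sequence_of_no_extension (h : IsExhaustion M p P) {q : H →L[ℂ] H}
    (hq : IsStarProjection q) (hqM : q ∈ M) {n : ℕ} (hle : SubEquiv M (p (n + 1)) q)
    {v : H →L[ℂ] H} (hv : v ∈ M) (hvp : star v * v = p n) (hqv : q * v = v)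
    (hno : ∀ v' ∈ M, star v' * v' = p (n + 1) → q * v' = v' → v' * p n ≠ v) :
    ∃ c ∈ M, IsStarProjection c ∧ c ≠ 0 ∧ P * c = c ∧
      ∃ w : ℕ → H →L[ℂ] H, (∀ k, w k ∈ M) ∧ (∀ k, star (w k) * w k = c) ∧
        (Pairwise fun j k => star (w j) * w k = 0) ∧ ∀ k, q * w k = w k := by
  have hvpn := mul_eq_self_of_star_mul_self (h.isStarProjection n) hvp
  have hvvv : v * star v * v = v := by rw [mul_assoc, hvp, hvpn]
  have hf : IsStarProjection (q - v * star v) :=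
    (isStarProjection_mul_star hvvv).sub_of_mul_eq_right hq (by rw [← mul_assoc, hqv])
  have he := h.isStarProjection_sub n
  have heM : p (n + 1) - p n ∈ M := sub_mem (h.mem _) (h.mem _)
  have hpe : p n * (p (n + 1) - p n) = 0 := by
    rw [mul_sub, h.mul_succ, (h.isStarProjection n).isIdempotentElem.eq, sub_self]
  have hep : (p (n + 1) - p n) * p n = 0 := by
    rw [sub_mul, h.mul_of_ge n.le_succ, (h.isStarProjection n).isIdempotentElem.eq, sub_self]
  have hep' : (p (n + 1) - p n) * p (n + 1) = p (n + 1) - p n := h.sub_mul_of_le le_rfl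
  have hpe' : p (n + 1) * (p (n + 1) - p n) = p (n + 1) - p n := by
    rw [mul_sub, h.mul_of_ge n.le_succ, (h.isStarProjection _).isIdempotentElem.eq]
  have hPe := h.limit_mul_sub h.isStarProjection_limit h.hasSum n
  have hes := he.isSelfAdjoint.star_eq
  have hei := he.isIdempotentElem.eq
  have heq : p n + (p (n + 1) - p n) = p (n + 1) := add_sub_cancel _ _
  generalize p (n + 1) - p n = e at he heM hpe hep hep' hpe' hPe hes hei heq
  obtain ⟨x, hx, hxxx, hxe, hfx, hmax⟩ := exists_maximal_partial_isometry he heM hf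
    (sub_mem hqM (mul_mem hv (star_mem hv)))
  have hqx : q * x = x := by
    rw [← hfx, ← mul_assoc, mul_sub, hq.isIdempotentElem.eq, ← mul_assoc, hqv]
  have hvx : star v * x = 0 := by
    have a1 : star v * q = star v := by
      simpa [hq.isSelfAdjoint.star_eq] using congr(star $hqv)
    have a2 : star v * (v * star v) = star v := by
      simpa [mul_assoc] using congr(star $hvvv)
    rw [← hfx, ← mul_assoc, mul_sub, a1, a2, sub_self, zero_mul]
  have hxv : star x * v = 0 := by simpa using congr(star $hvx)
  have hxp : x * p n = 0 := by rw [← hxe, mul_assoc, hep, mul_zero]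
  have hvxs : v * star x = 0 := by
    have := congr(star $hxp)
    rw [star_mul, (h.isStarProjection n).isSelfAdjoint.star_eq, star_zero] at this
    rw [← hvpn, mul_assoc, this, mul_zero]
  have hxvs : x * star v = 0 := by simpa using congr(star $hvxs)
  set X := v + x with hX
  have hXM : X ∈ M := add_mem hv hx
  have hXX : star X * X = p n + star x * x := by
    rw [hX, star_add, add_mul, mul_add, mul_add, hvx, hxv, hvp, add_zero, zero_add]
  have hXX' : X * star X = v * star v + x * star x := by
    rw [hX, star_add, add_mul, mul_add, mul_add, hvxs, hxvs, add_zero, zero_add]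
  have hqX : q * X = X := by rw [hX, mul_add, hqv, hqx]
  set c := e - star x * x with hc
  have hcP : IsStarProjection c :=
    (isStarProjection_star_mul hxxx).sub_of_mul_eq_left he (by rw [mul_assoc, hxe])
  have hcM : c ∈ M := sub_mem heM (mul_mem (star_mem hx) hx)
  have hec : e * c = c := by
    have a1 : e * star x = star x := by simpa [hes] using congr(star $hxe)
    rw [hc, mul_sub, hei, ← mul_assoc, a1]
  have hc0 : c ≠ 0 := by
    intro h0
    refine hno X hXM ?_ hqX ?_
    · rw [hXX, ← sub_eq_zero.1 h0, heq]
    · rw [hX, add_mul, hvpn, hxp, add_zero]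
  have hXc : X * c = 0 := by
    rw [hX, add_mul, ← hec, ← mul_assoc v, ← hvpn, mul_assoc v, hpe, mul_zero, zero_mul,
      zero_add, hec, hc, mul_sub, hxe, ← mul_assoc, hxxx, sub_self]
  have hcX : c * star X = 0 := by
    simpa [hcP.isSelfAdjoint.star_eq] using congr(star $hXc)
  have hXp : X * p (n + 1) = X := by
    have a1 : v * p (n + 1) = v := by
      rw [← hvpn, mul_assoc, h.mul_succ]
    have a2 : x * p (n + 1) = x := by
      rw [← hxe, mul_assoc, hep']
    rw [hX, add_mul, a1, a2]
  have hpc : p (n + 1) * c = c := by rw [← hec, ← mul_assoc, hpe']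
  have hcp : c * p (n + 1) = c := by
    simpa [hcP.isSelfAdjoint.star_eq, (h.isStarProjection _).isSelfAdjoint.star_eq]
      using congr(star $hpc)
  obtain ⟨w, hw, hwp, hqw⟩ := hle
  obtain ⟨W, hW0, hWs⟩ : ∃ W : ℕ → H →L[ℂ] H, W 0 = w * c ∧
      ∀ k, W (k + 1) = w * star X * W k :=
    ⟨fun k => Nat.rec (w * c) (fun _ y => w * star X * y) k, rfl, fun _ => rfl⟩
  have hWM : ∀ k, W k ∈ M := by
    intro k
    induction k with
    | zero => exact hW0 ▸ mul_mem hw hcM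
    | succ k ih => exact hWs k ▸ mul_mem (mul_mem hw (star_mem hXM)) ih
  have hWc : ∀ k, W k * c = W k := by
    intro k
    induction k with
    | zero => rw [hW0, mul_assoc, hcP.isIdempotentElem.eq]
    | succ k ih => rw [hWs, mul_assoc, ih]
  have hqW : ∀ k, q * W k = W k := by
    intro k
    cases k with
    | zero => rw [hW0, ← mul_assoc, hqw]
    | succ k => rw [hWs, ← mul_assoc, ← mul_assoc, hqw]
  have hXXW : ∀ k, X * (star X * W k) = W k := by
    intro k
    have a1 := hmax (W k) (hWM k)
    rw [mul_assoc, hWc, sub_sub, ← hXX', sub_mul, hqW, sub_eq_zero, mul_assoc] at a1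
    exact a1.symm
  have hstep : ∀ j k, star (W (j + 1)) * W (k + 1) = star (W j) * W k := by
    intro j k
    rw [hWs, hWs, star_mul, star_mul, star_star, mul_assoc, mul_assoc, mul_assoc w,
      ← mul_assoc (star w), hwp, ← mul_assoc X (p (n + 1)), hXp, hXXW]
  have hlt : ∀ j k, star (W j) * W (j + k + 1) = 0 := by
    intro j k
    induction j with
    | zero =>
      rw [zero_add, hWs, hW0, star_mul, hcP.isSelfAdjoint.star_eq, mul_assoc, mul_assoc w,
        ← mul_assoc (star w), hwp, ← mul_assoc c, hcp, ← mul_assoc, hcX, zero_mul]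
    | succ j ih => rw [show j + 1 + k + 1 = j + k + 1 + 1 by omega, hstep, ih]
  refine ⟨c, hcM, hcP, hc0, by rw [← hec, ← mul_assoc, hPe], W, hWM, fun k => ?_,
    fun j k hjk => ?_, hqW⟩
  · induction k with
    | zero =>
      rw [hW0, star_mul, mul_assoc, ← mul_assoc (star w), hwp, hpc,
        hcP.isSelfAdjoint.star_eq, hcP.isIdempotentElem.eq]
    | succ k ih => rw [hstep, ih]
  · rcases lt_or_gt_of_ne hjk with h' | h'
    · obtain ⟨i, rfl⟩ := Nat.exists_eq_add_of_lt h'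
      exact hlt j i
    · obtain ⟨i, rfl⟩ := Nat.exists_eq_add_of_lt h'
      simpa using congr(star $(hlt k i))

/-- Either the embeddings of the members of an exhaustion into `q` assemble to an embedding of the
limit, or `q` contains infinitely many orthogonal copies of a nonzero projection. -/
theorem subEquiv_or_exists_sequence (h : IsExhaustion M p P) {q : H →L[ℂ] H}
    (hq : IsStarProjection q) (hqM : q ∈ M) (hle : ∀ n, SubEquiv M (p n) q) :
    SubEquiv M P q ∨ ∃ c ∈ M, IsStarProjection c ∧ c ≠ 0 ∧ P * c = c ∧
      ∃ w : ℕ → H →L[ℂ] H, (∀ k, w k ∈ M) ∧ (∀ k, star (w k) * w k = c) ∧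
        (Pairwise fun j k => star (w j) * w k = 0) ∧ ∀ k, q * w k = w k := by
  by_cases hext : ∀ n, ∀ v ∈ M, star v * v = p n → q * v = v →
      ∃ v', (v' ∈ M ∧ star v' * v' = p (n + 1) ∧ q * v' = v') ∧ v' * p n = v
  · exact .inl (h.subEquiv_of_extension hext)
  · push Not at hext
    obtain ⟨n, v, hv, hvp, hqv, hno⟩ := hext
    exact .inr (h.exists_sequence_of_no_extension hq hqM (hle _) hv hvp hqv
      fun v' h1 h2 h3 => hno v' ⟨h1, h2, h3⟩)

end IsExhaustion

end Exhaustion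

section Central

variable {H : Type*} [NormedAddCommGroup H] [InnerProductSpace ℂ H] [CompleteSpace H]
  {M : VonNeumannAlgebra H}

/-- A projection in the center of `M`. -/
structure IsCentralProjection (M : VonNeumannAlgebra H) (z : H →L[ℂ] H) : Prop where
  mem : z ∈ M
  isStarProjection : IsStarProjection z
  commute : ∀ m ∈ M, Commute m z

namespace IsCentralProjection

variable {z y : H →L[ℂ] H}

theorem mul (hz : IsCentralProjection M z) (hy : IsCentralProjection M y) :
    IsCentralProjection M (z * y) where
  mem := mul_mem hz.mem hy.mem
  isStarProjection := hz.isStarProjection.mul hy.isStarProjection (hy.commute z hz.mem)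
  commute m hm := (hz.commute m hm).mul_right (hy.commute m hm)

theorem one_sub (hz : IsCentralProjection M z) : IsCentralProjection M (1 - z) where
  mem := sub_mem (one_mem M) hz.mem
  isStarProjection := hz.isStarProjection.one_sub
  commute m hm := (Commute.one_right m).sub_right (hz.commute m hm)

theorem subEquiv (hz : IsCentralProjection M z) {p q : H →L[ℂ] H} (hpq : SubEquiv M p q) :
    SubEquiv M (z * p) (z * q) := by
  obtain ⟨v, hv, hvp, hqv⟩ := hpq
  have hzv := (hz.commute v hv).eq
  have hzz := hz.isStarProjection.isIdempotentElem.eq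
  refine ⟨v * z, mul_mem hv hz.mem, ?_, ?_⟩
  · rw [star_mul, hz.isStarProjection.isSelfAdjoint.star_eq, mul_assoc, ← mul_assoc (star v), hvp,
      ← hvp, (hz.commute (star v * v) (mul_mem (star_mem hv) hv)).eq, ← mul_assoc, hzz]
  · rw [mul_assoc, ← mul_assoc q, hqv, hzv, ← mul_assoc, hzz]

end IsCentralProjection

theorem IsExhaustion.central_mul {p : ℕ → H →L[ℂ] H} {P z : H →L[ℂ] H}
    (h : IsExhaustion M p P) (hPM : P ∈ M) (hz : IsCentralProjection M z) :
    IsExhaustion M (fun n => z * p n) (z * P) where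
  isStarProjection n :=
    hz.isStarProjection.mul (h.isStarProjection n) (hz.commute _ (h.mem n)).symm
  mem n := mul_mem hz.mem (h.mem n)
  zero := by rw [h.zero, mul_zero]
  mul_succ n := by
    rw [mul_assoc, ← mul_assoc (p n), (hz.commute _ (h.mem n)).eq, mul_assoc, h.mul_succ,
      ← mul_assoc, hz.isStarProjection.isIdempotentElem.eq]
  isStarProjection_limit :=
    hz.isStarProjection.mul h.isStarProjection_limit (hz.commute _ hPM).symm
  hasSum x := by
    simp_rw [← mul_sub]
    exact mul_hasSum z h.hasSum x

theorem IsExhaustion.limit_mem {p : ℕ → H →L[ℂ] H} {P : H →L[ℂ] H}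
    (h : IsExhaustion M p P) : P ∈ M :=
  mem_of_hasSum (fun n => sub_mem (h.mem (n + 1)) (h.mem n)) h.hasSum

/-- The sum of an orthogonal family of subequivalences. -/
theorem SubEquiv.of_hasSum {ι : Type*} {p q : ι → H →L[ℂ] H} {P Q : H →L[ℂ] H}
    (hpq : ∀ i, SubEquiv M (p i) (q i)) (hq : ∀ i, star (q i) = q i)
    (horth : ∀ i j, i ≠ j → q i * q j = 0) (hQ : ∀ i, Q * q i = q i)
    (hP : ∀ x, HasSum (fun i => p i x) (P x)) : SubEquiv M P Q := by
  choose v hv hvp hqv using hpq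
  obtain ⟨V, hV, hVP⟩ := exists_hasSum_of_orthogonal_range (V := v) (p := P) (fun i j hij => by
    change star (v i) * v j = 0
    rw [← hqv i, ← hqv j, star_mul, hq, mul_assoc, ← mul_assoc (q i), horth i j hij, zero_mul,
      mul_zero]) (by simpa only [hvp] using hP)
  refine ⟨V, mem_of_hasSum hv hV, hVP, ?_⟩
  rw [mul_eq_of_hasSum hV (b := 1) fun i => by
    rw [← hqv i, ← mul_assoc, hQ, one_mul], one_mul]

/-- An infinite family of orthogonal copies of `c` in `q` yields, below a nonzero central projection
meeting `c`, infinitely many orthogonal copies of `q` in itself. -/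
theorem exists_central_copies {q c : H →L[ℂ] H} (hq : IsStarProjection q) (hqM : q ∈ M)
    (hc : IsStarProjection c) (hcM : c ∈ M) (hc0 : c ≠ 0) {w : ℕ → H →L[ℂ] H}
    (hwM : ∀ k, w k ∈ M) (hwc : ∀ k, star (w k) * w k = c)
    (hwo : Pairwise fun j k => star (w j) * w k = 0) (hqw : ∀ k, q * w k = w k) :
    ∃ z, IsCentralProjection M z ∧ z * c ≠ 0 ∧ ∃ g : ℕ → H →L[ℂ] H, (∀ n, g n ∈ M) ∧
      (∀ n, star (g n) * g n = z * q) ∧ (∀ m n, m ≠ n → star (g m) * g n = 0) ∧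
      ∀ n, (z * q) * g n = g n := by
  let S : Set (Set (H →L[ℂ] H)) :=
    {X | (∀ u ∈ X, u ∈ M ∧ star u * u = c ∧ q * u = u) ∧ X.Pairwise fun a b => star a * b = 0}
  have hwS : Set.range w ∈ S := by
    refine ⟨?_, ?_⟩
    · rintro _ ⟨k, rfl⟩
      exact ⟨hwM k, hwc k, hqw k⟩
    · rintro _ ⟨j, rfl⟩ _ ⟨k, rfl⟩ hjk
      exact hwo fun h => hjk (h ▸ rfl)
  obtain ⟨X, hwX, ⟨hX, hXp⟩, hmax⟩ := zorn_subset_nonempty S (fun c hc hchain _ => by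
    refine ⟨⋃₀ c, ⟨?_, ?_⟩, fun s => Set.subset_sUnion_of_mem⟩
    · rintro w ⟨s, hs, hw⟩
      exact (hc hs).1 w hw
    · exact (Set.pairwise_sUnion hchain.directedOn).2 fun s hs => (hc hs).2) _ hwS
  have hwinj : Function.Injective w := fun j k hjk => by
    by_contra hne
    have h1 : star (w j) * w k = 0 := hwo hne
    rw [← hjk, hwc] at h1
    exact hc0 h1
  have hXinf : Infinite X := ((Set.infinite_range_of_injective hwinj).mono hwX).to_subtype
  have huc : ∀ u ∈ X, u * c = u := fun u hu => mul_eq_self_of_star_mul_self hc (hX u hu).2.1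
  have huuu : ∀ u ∈ X, u * star u * u = u := fun u hu => by
    rw [mul_assoc, (hX u hu).2.1, huc u hu]
  have hXo : ∀ i j : X, i ≠ j → star i.1 * j.1 = 0 :=
    fun i j hij => hXp i.2 j.2 fun h => hij (Subtype.ext h)
  obtain ⟨s, hs, hsum⟩ := exists_hasSum_projection (P := fun u : X => u.1 * star u.1)
    (fun u => isStarProjection_mul_star (huuu u u.2)) (fun i j hij => by
      change i.1 * star i.1 * (j.1 * star j.1) = 0
      rw [mul_assoc, ← mul_assoc (star i.1), hXo i j hij, zero_mul, mul_zero])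
  have hsM : s ∈ M := mem_of_hasSum (V := fun u : X => u.1 * star u.1)
    (fun u => mul_mem (hX u u.2).1 (star_mem (hX u u.2).1)) hsum
  have hqs : q * s = s := by
    rw [mul_eq_of_hasSum hsum (b := 1) fun u => by
      rw [← mul_assoc, (hX u u.2).2.2, one_mul], one_mul]
  have hus : ∀ u : X, star u.1 * s = star u.1 := fun u => by
    rw [mul_single_of_hasSum u hsum fun j hj => by
      rw [← mul_assoc, hXo u j hj.symm, zero_mul]]
    simpa [mul_assoc] using congr(star $(huuu u u.2))
  have hr : IsStarProjection (q - s) := hs.sub_of_mul_eq_right hq hqs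
  have huq : ∀ u : X, star u.1 * q = star u.1 := fun u => by
    simpa [hq.isSelfAdjoint.star_eq] using congr(star $((hX u u.2).2.2))
  have hur : ∀ u : X, star u.1 * (q - s) = 0 := fun u => by
    rw [mul_sub, huq, hus, sub_self]
  obtain ⟨v, hv, hvvv, hvc, hrv, hvmax⟩ :=
    exists_maximal_partial_isometry hc hcM hr (sub_mem hqM hsM)
  have huv : ∀ u : X, star u.1 * v = 0 := fun u => by rw [← hrv, ← mul_assoc, hur, zero_mul]
  have hqv : q * v = v := by
    rw [← hrv, ← mul_assoc, mul_sub, hq.isIdempotentElem.eq, hqs]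
  have hc2 : c * (c - star v * v) = c - star v * v := by
    have a1 : c * star v = star v := by simpa [hc.isSelfAdjoint.star_eq] using congr(star $hvc)
    rw [mul_sub, hc.isIdempotentElem.eq, ← mul_assoc, a1]
  have hc20 : c - star v * v ≠ 0 := by
    intro h0
    have hvX : v ∉ X := fun h => hc0 <| by rw [sub_eq_zero.1 h0, huv ⟨v, h⟩]
    refine hvX (hmax (y := insert v X) ⟨?_, ?_⟩ (Set.subset_insert v X) (Set.mem_insert v X))
    · rintro u (rfl | hu)
      · exact ⟨hv, (sub_eq_zero.1 h0).symm, hqv⟩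
      · exact hX u hu
    · refine (Set.pairwise_insert_of_notMem hvX).2 ⟨hXp, fun b hb => ⟨?_, huv ⟨b, hb⟩⟩⟩
      simpa using congr(star $(huv ⟨b, hb⟩))
  obtain ⟨z, hzM, hzp, hzc, hz1, hz2⟩ := exists_central_support
    (sub_mem hcM (mul_mem (star_mem hv) hv))
  have hz : IsCentralProjection M z := ⟨hzM, hzp, hzc⟩
  have hzr : z * (q - s - v * star v) = 0 := by
    rw [← (hzc _ (sub_mem (sub_mem hqM hsM) (mul_mem hv (star_mem hv)))).eq]
    exact hz2 _ hvmax
  have hzi := hzp.isIdempotentElem.eq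
  have hzs := hzp.isSelfAdjoint.star_eq
  refine ⟨z, hz, fun h0 => hc20 ?_, ?_⟩
  · rw [← hz1, ← hc2, ← mul_assoc, h0, zero_mul]
  let α : X ⊕ Unit → H →L[ℂ] H := Sum.elim (fun u => u.1) fun _ => v
  have hαM : ∀ o, α o ∈ M := by
    rintro (u | _)
    exacts [(hX u u.2).1, hv]
  have hαc : ∀ o, α o * c = α o := by
    rintro (u | _)
    exacts [huc u u.2, hvc]
  have hαsum : ∀ x, HasSum (fun o => (z * (α o * star (α o))) x) ((z * q) x) := by
    have h1 : z * q = z * (s + v * star v) := by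
      rw [← sub_eq_zero, ← mul_sub, ← sub_sub, hzr]
    rw [h1]
    refine mul_hasSum z fun x => HasSum.sum (hsum x) ?_
    exact hasSum_unique (f := fun _ : Unit => (v * star v) x)
  obtain ⟨σ⟩ : Nonempty ((X ⊕ Unit) × ℕ ≃ X) := by
    refine Cardinal.eq.1 ?_
    have h1 : Cardinal.aleph0 ≤ Cardinal.mk X := Cardinal.aleph0_le_mk X
    simp only [Cardinal.mk_prod, Cardinal.mk_sum, Cardinal.lift_uzero,
      Cardinal.mk_fintype, Fintype.card_unit, Cardinal.mk_nat, Cardinal.lift_aleph0, Nat.cast_one,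
      Cardinal.lift_one]
    rw [Cardinal.add_one_eq h1, Cardinal.mul_aleph0_eq h1]
  have hσo : ∀ a b, a ≠ b → star (σ a).1 * (σ b).1 = 0 :=
    fun a b hab => hXo _ _ fun h => hab (σ.injective h)
  have hterm : ∀ n o, star ((σ (o, n)).1 * (star (α o) * z)) * ((σ (o, n)).1 * (star (α o) * z)) =
      z * (α o * star (α o)) := by
    intro n o
    rw [star_mul, star_mul, star_star, hzs, mul_assoc, ← mul_assoc (star (σ (o, n)).1),
      (hX _ (σ (o, n)).2).2.1, (hzc _ (star_mem (hαM o))).eq, mul_assoc z (α o),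
      ← mul_assoc (α o) c, hαc, ← mul_assoc (α o) z, (hzc _ (hαM o)).eq, mul_assoc z (α o),
      ← mul_assoc z z, hzi]
  have hterm0 : ∀ m n o o', (o, m) ≠ (o', n) →
      star ((σ (o, m)).1 * (star (α o) * z)) * ((σ (o', n)).1 * (star (α o') * z)) = 0 := by
    intro m n o o' hne
    rw [star_mul, mul_assoc, ← mul_assoc (star (σ (o, m)).1), hσo _ _ hne, zero_mul, mul_zero]
  have hg : ∀ n, ∃ g : H →L[ℂ] H,
      (∀ x, HasSum (fun o => ((σ (o, n)).1 * (star (α o) * z)) x) (g x)) ∧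
        star g * g = z * q := fun n =>
    exists_hasSum_of_orthogonal_range
      (fun o o' hne => hterm0 n n o o' fun h => hne (Prod.ext_iff.1 h).1)
      (by simpa only [hterm] using hαsum)
  choose g hgs hgg using hg
  refine ⟨g, fun n => mem_of_hasSum (fun o => mul_mem (hX _ (σ (o, n)).2).1
    (mul_mem (star_mem (hαM o)) hzM)) (hgs n), hgg, fun m n hmn => ?_, fun n => ?_⟩
  · rw [mul_eq_of_hasSum (hgs n) (a := star (g m)) (b := 0) fun o => ?_, zero_mul]
    rw [zero_mul, ← star_star ((σ (o, n)).1 * (star (α o) * z)), ← star_mul,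
      mul_eq_of_hasSum (hgs m) (b := 0) fun o' => ?_, zero_mul, star_zero]
    rw [hterm0 n m o o' fun h => hmn (Prod.ext_iff.1 h).2.symm, zero_mul]
  · rw [mul_eq_of_hasSum (hgs n) (b := 1) fun o => ?_, one_mul]
    rw [mul_assoc z, ← mul_assoc q, (hX _ (σ (o, n)).2).2.2, ← mul_assoc z,
      ← (hzc _ (hX _ (σ (o, n)).2).1).eq, mul_assoc, ← mul_assoc z,
      ← (hzc _ (star_mem (hαM o))).eq, mul_assoc, hzi, one_mul]

theorem IsExhaustion.subEquiv_of_copies {p : ℕ → H →L[ℂ] H} {P q z : H →L[ℂ] H}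
    (h : IsExhaustion M p P) (hle : ∀ n, SubEquiv M (p n) q) (hz : IsCentralProjection M z)
    {g : ℕ → H →L[ℂ] H} (hgM : ∀ n, g n ∈ M) (hgg : ∀ n, star (g n) * g n = z * q)
    (hgo : ∀ m n, m ≠ n → star (g m) * g n = 0) (hzg : ∀ n, z * q * g n = g n) :
    SubEquiv M (z * P) (z * q) := by
  refine SubEquiv.of_hasSum (p := fun n => z * (p (n + 1) - p n))
    (q := fun n => g n * star (g n)) (fun n => ?_) (fun n => by simp) (fun m n hmn => ?_)
    (fun n => by rw [← mul_assoc, hzg]) (fun x => mul_hasSum z h.hasSum x)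
  · obtain ⟨v, hv, hvp, hqv⟩ := hz.subEquiv (hle (n + 1))
    have hB := h.isStarProjection_sub n
    have hBM : p (n + 1) - p n ∈ M := sub_mem (h.mem _) (h.mem _)
    refine ⟨g n * (v * (p (n + 1) - p n)), mul_mem (hgM n) (mul_mem hv hBM), ?_, ?_⟩
    · rw [star_mul, star_mul, mul_assoc, ← mul_assoc (star (g n)), hgg, ← mul_assoc (z * q), hqv,
        mul_assoc, ← mul_assoc (star v), hvp, hB.isSelfAdjoint.star_eq,
        ← (hz.commute _ (h.mem _)).eq, ← mul_assoc, ← mul_assoc, h.sub_mul_of_le le_rfl,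
        (hz.commute _ hBM).eq, mul_assoc, hB.isIdempotentElem.eq]
    · rw [mul_assoc, ← mul_assoc (star (g n)), hgg, ← mul_assoc (z * q), hqv]
  · rw [mul_assoc, ← mul_assoc (star (g m)), hgo m n hmn, zero_mul, mul_zero]

/-- A projection is subequivalent to `q` as soon as it has an exhaustion by such projections. -/
theorem IsExhaustion.subEquiv {p : ℕ → H →L[ℂ] H} {P q : H →L[ℂ] H} (h : IsExhaustion M p P)
    (hq : IsStarProjection q) (hqM : q ∈ M) (hle : ∀ n, SubEquiv M (p n) q) :
    SubEquiv M P q := by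
  have hqi := hq.isIdempotentElem.eq
  let S : Set (Set (H →L[ℂ] H)) :=
    {X | (∀ z ∈ X, IsCentralProjection M z ∧ SubEquiv M (z * P) (z * q)) ∧
      X.Pairwise fun a b => a * b = 0}
  obtain ⟨X, ⟨hX, hXp⟩, hmax⟩ : ∃ X, Maximal (· ∈ S) X := by
    refine zorn_subset S fun c hc hchain => ⟨⋃₀ c, ⟨?_, ?_⟩, fun s => Set.subset_sUnion_of_mem⟩
    · rintro w ⟨s, hs, hw⟩
      exact (hc hs).1 w hw
    · exact (Set.pairwise_sUnion hchain.directedOn).2 fun s hs => (hc hs).2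
  have hXo : ∀ i j : X, i ≠ j → i.1 * j.1 = 0 :=
    fun i j hij => hXp i.2 j.2 fun h => hij (Subtype.ext h)
  obtain ⟨e, he, hsum⟩ := exists_hasSum_projection (P := fun z : X => z.1)
    (fun z => (hX z z.2).1.isStarProjection) (fun i j hij => hXo i j hij)
  have hzcomm : ∀ z : X, ∀ m ∈ M, m * z.1 = z.1 * m := fun z m hm => ((hX z z.2).1.commute m hm).eq
  have heM : IsCentralProjection M e := by
    refine ⟨mem_of_hasSum (V := fun z : X => z.1) (fun z => (hX z z.2).1.mem) hsum, he,
      fun m hm => commute_of_hasSum hsum fun z => hzcomm z m hm⟩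
  have hze : ∀ z : X, z.1 * e = z.1 := fun z => by
    rw [mul_single_of_hasSum z hsum fun j hj => hXo z j hj.symm,
      (hX z z.2).1.isStarProjection.isIdempotentElem.eq]
  have hqc : ∀ z, IsCentralProjection M z → star (z * q) = z * q := fun z hz =>
    (hz.isStarProjection.mul hq (hz.commute q hqM).symm).isSelfAdjoint.star_eq
  have hqq : ∀ z, IsCentralProjection M z → q * (z * q) = z * q := fun z hz => by
    rw [← mul_assoc, (hz.commute q hqM).eq, mul_assoc, hqi]
  have hmulq : ∀ a b, IsCentralProjection M b → a * b = 0 → a * q * (b * q) = 0 := by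
    intro a b hb hab
    rw [mul_assoc, hqq b hb, ← mul_assoc, hab, zero_mul]
  have hez : ∀ z : X, e * z.1 = z.1 := fun z => by
    rw [← (heM.commute z.1 (hX z z.2).1.mem).eq, hze]
  have h0 : SubEquiv M (e * P) (e * q) :=
    SubEquiv.of_hasSum (p := fun z : X => z.1 * P) (q := fun z : X => z.1 * q)
      (fun z => (hX z z.2).2) (fun z => hqc z (hX z z.2).1)
      (fun i j hij => hmulq _ _ (hX j j.2).1 (hXo i j hij))
      (fun z => by rw [mul_assoc, hqq _ (hX z z.2).1, ← mul_assoc, hez]) fun x => hsum (P x)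
  have hy := heM.one_sub
  have hey : e * (1 - e) = 0 := he.mul_one_sub_self
  have hye : (1 - e) * e = 0 := he.one_sub_mul_self
  have hex := h.central_mul h.limit_mem hy
  have hle' := fun n => hy.subEquiv (hle n)
  rcases hex.subEquiv_or_exists_sequence
    (hy.isStarProjection.mul hq (hy.commute q hqM).symm) (mul_mem hy.mem hqM)
    hle' with h1 | ⟨c, hcM, hc, hc0, hPc, w, hwM, hwc, hwo, hqw⟩
  · obtain ⟨v₀, hv₀, hvp₀, hqv₀⟩ := h0
    obtain ⟨v₁, hv₁, hvp₁, hqv₁⟩ := h1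
    have h01 : star v₀ * v₁ = 0 := by
      rw [← hqv₀, ← hqv₁, star_mul, hqc e heM, mul_assoc, ← mul_assoc (e * q), hmulq e _ hy hey,
        zero_mul, mul_zero]
    have h10 : star v₁ * v₀ = 0 := by simpa using congr(star $h01)
    refine ⟨v₀ + v₁, add_mem hv₀ hv₁, ?_, ?_⟩
    · rw [star_add, add_mul, mul_add, mul_add, h01, h10, hvp₀, hvp₁, add_zero, zero_add, ← add_mul,
        add_sub_cancel, one_mul]
    · have hqv₀' : q * v₀ = v₀ := by rw [← hqv₀, ← mul_assoc, hqq e heM]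
      have hqv₁' : q * v₁ = v₁ := by rw [← hqv₁, ← mul_assoc, hqq _ hy]
      rw [mul_add, hqv₀', hqv₁']
  · exfalso
    obtain ⟨z, hz, hzc, g, hgM, hgg, hgo, hzg⟩ := exists_central_copies
      (hy.isStarProjection.mul hq (hy.commute q hqM).symm) (mul_mem hy.mem hqM) hc hcM hc0
      hwM hwc hwo hqw
    have h1 := hex.subEquiv_of_copies hle' hz hgM hgg hgo hzg
    rw [← mul_assoc, ← mul_assoc] at h1
    have hzy := hz.mul hy
    have hyc : (1 - e) * c = c := by
      rw [← hPc, ← mul_assoc, ← mul_assoc, hy.isStarProjection.isIdempotentElem.eq]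
    have hzye : z * (1 - e) * e = 0 := by rw [mul_assoc, hye, mul_zero]
    have hzyX : z * (1 - e) ∉ X := fun hmem => hzc <| by
      have h2 : z * (1 - e) = z * (1 - e) * e := (hze ⟨_, hmem⟩).symm
      rw [← hyc, ← mul_assoc, h2, hzye, zero_mul]
    have hzyo : ∀ b : X, z * (1 - e) * b.1 = 0 := fun b => by
      rw [← hez b, ← mul_assoc, hzye, zero_mul]
    refine hzyX (hmax (y := insert (z * (1 - e)) X) ⟨?_, ?_⟩ (Set.subset_insert _ X)
      (Set.mem_insert _ X))
    · rintro u (rfl | hu)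
      · exact ⟨hzy, h1⟩
      · exact hX u hu
    · refine (Set.pairwise_insert_of_notMem hzyX).2 ⟨hXp, fun b hb => ⟨hzyo ⟨b, hb⟩, ?_⟩⟩
      rw [← (hzcomm ⟨b, hb⟩ _ hzy.mem), hzyo ⟨b, hb⟩]

end Central

section RangeProjection

variable {H : Type*} [NormedAddCommGroup H] [InnerProductSpace ℂ H] [CompleteSpace H]
  {M : VonNeumannAlgebra H}

theorem mul_rangeProj_eq_self {t a : H →L[ℂ] H} (h : a * t = t) :
    a * rangeProj t = rangeProj t := by
  rw [mul_rangeProj_congr (b := 1) (by rw [h, one_mul]), one_mul]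

theorem rangeProj_mul_star_self (t : H →L[ℂ] H) : rangeProj (t * star t) = rangeProj t := by
  set r := rangeProj (t * star t)
  have hr : IsStarProjection r := isStarProjection_rangeProj _
  have h1 : r * t = t := by
    have h : (r * t - t) * star t = 0 := by
      rw [sub_mul, mul_assoc, sub_eq_zero]
      exact rangeProj_mul _
    rw [← sub_eq_zero, ← CStarRing.mul_star_self_eq_zero_iff, star_sub, star_mul, mul_sub,
      ← mul_assoc, h, zero_mul, sub_zero]
  have h2 : r * rangeProj t = rangeProj t := mul_rangeProj_eq_self h1
  have h3 : rangeProj t * r = r := mul_rangeProj_eq_self (by rw [← mul_assoc, rangeProj_mul])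
  have h4 := congr(star $h3)
  rw [star_mul, hr.isSelfAdjoint.star_eq, (isStarProjection_rangeProj t).isSelfAdjoint.star_eq,
    h2] at h4
  exact h4.symm

theorem cfc_real_mem {T : H →L[ℂ] H} (hTM : T ∈ M) (f : ℝ → ℝ) :
    cfc f T ∈ M :=
  mem_of_commute_commutant fun _ hy =>
    ((commute_of_mem_commutant hy hTM).symm.cfc_real f).symm

/-- The range projection of a positive operator is exhausted by projections below which the operator
is bounded from below. -/
theorem exists_isExhaustion_rangeProj {T : H →L[ℂ] H} (hTM : T ∈ M) (hT : 0 ≤ T) :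
    ∃ p, IsExhaustion M p (rangeProj T) ∧
      ∀ n, ∃ C : ℝ, 0 < C ∧ ∀ y, ‖p n y‖ ≤ C * ‖T (p n y)‖ := by
  have hTs : IsSelfAdjoint T := IsSelfAdjoint.of_nonneg hT
  let f : ℕ → ℝ → ℝ := fun n x => max (n * x - 1) 0
  have hf : ∀ n, Continuous (f n) := fun n => by fun_prop
  have hfpos : ∀ n x, f n x ≠ 0 → 0 < x ∧ (n + 1 : ℝ)⁻¹ ≤ x := by
    intro n x hx
    have h1 : 1 < n * x := by
      by_contra! h
      exact hx (max_eq_right (by linarith))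
    have hn : (0 : ℝ) ≤ n := n.cast_nonneg
    have h2 : 0 < x := by
      by_contra! h
      nlinarith
    refine ⟨h2, (inv_le_iff_one_le_mul₀ (by positivity)).2 (by nlinarith)⟩
  let F : ℕ → H →L[ℂ] H := fun n => cfc (f n) T
  have hfactor : ∀ (n : ℕ) (g : ℝ → ℝ), Continuous g →
      (∀ x, f n x ≠ 0 → (n + 1 : ℝ)⁻¹ ≤ g x) → ∃ K, F n = cfc g T * K := by
    intro n g hg hgf
    have hn : (0 : ℝ) < (n + 1 : ℝ)⁻¹ := by positivity
    have hmax : ∀ x, max (g x) (n + 1 : ℝ)⁻¹ ≠ 0 := fun x => (lt_max_of_lt_right hn).ne'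
    have hk : Continuous fun x => f n x / max (g x) (n + 1 : ℝ)⁻¹ :=
      (hf n).div (hg.max continuous_const) hmax
    refine ⟨cfc (fun x => f n x / max (g x) (n + 1 : ℝ)⁻¹) T, ?_⟩
    rw [← cfc_mul g _ T hg.continuousOn hk.continuousOn]
    refine cfc_congr fun x _ => ?_
    by_cases hx : f n x = 0
    · simp [hx]
    · have h1 := hgf x hx
      have h2 : g x ≠ 0 := (hn.trans_le h1).ne'
      rw [max_eq_left h1, mul_div_cancel₀ _ h2]
  have hTid : cfc (fun x : ℝ => x) T = T := cfc_id' ℝ T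
  have hp : IsProjectionSeq M fun n => rangeProj (F n) := by
    refine ⟨fun n => isStarProjection_rangeProj _, fun n => rangeProj_mem (cfc_real_mem hTM _), ?_,
      fun n => ?_⟩
    · have h1 : F 0 = 0 := by
        have : f 0 = fun _ => 0 := by ext x; simp [f]
        simp only [F, this]
        exact cfc_const_zero ℝ T
      have h2 : (0 : H →L[ℂ] H) * F 0 = 1 * F 0 := by rw [h1, mul_zero, mul_zero]
      simpa using (mul_rangeProj_congr h2).symm
    · obtain ⟨K, hK⟩ := hfactor n (f (n + 1)) (hf _) fun x hx => by
        obtain ⟨h1, h2⟩ := hfpos n x hx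
        have h3 : 1 < n * x := by
          by_contra! h
          exact hx (max_eq_right (by linarith))
        refine le_trans ?_ (le_max_left _ _)
        push_cast
        linarith
      have h1 : rangeProj (F (n + 1)) * rangeProj (F n) = rangeProj (F n) :=
        mul_rangeProj_eq_self (by rw [hK, ← mul_assoc, rangeProj_mul])
      simpa [(isStarProjection_rangeProj _).isSelfAdjoint.star_eq] using congr(star $h1)
  refine ⟨_, hp.isExhaustion (isStarProjection_rangeProj T) (fun n => ?_) fun a ha => ?_,
    fun n => ?_⟩
  · obtain ⟨K, hK⟩ := hfactor n (fun x => x) continuous_id fun x hx => (hfpos n x hx).2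
    exact mul_rangeProj_eq_self (by rw [hK, hTid, ← mul_assoc, rangeProj_mul])
  · have haF : ∀ n, a * F n = 0 := fun n => by
      rw [← rangeProj_mul (F n), ← mul_assoc, ha n, zero_mul]
    have hbound : ∀ n : ℕ, ‖a * T‖ ≤ ‖a‖ * (1 / ((n : ℝ) + 1)) := by
      intro n
      have hn : (0 : ℝ) < (n : ℝ) + 1 := by positivity
      have h1 : a * T = a * cfc (fun x => x - (1 / ((n : ℝ) + 1)) * f (n + 1) x) T := by
        rw [cfc_sub (fun x : ℝ => x) (fun x => (1 / ((n : ℝ) + 1)) * f (n + 1) x) T continuousOn_id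
          ((continuous_const.mul (hf _)).continuousOn), hTid,
          cfc_const_mul _ (f (n + 1)) T (hf _).continuousOn, mul_sub, mul_smul_comm, haF (n + 1),
          smul_zero, sub_zero]
      rw [h1]
      refine (norm_mul_le _ _).trans ?_
      gcongr
      refine norm_cfc_le (by positivity) fun x hx => ?_
      have hx0 : 0 ≤ x := spectrum_nonneg_of_nonneg hT hx
      have h2 : (1 / ((n : ℝ) + 1)) * f (n + 1) x = max (x - 1 / ((n : ℝ) + 1)) 0 := by
        simp only [f]
        rw [mul_max_of_nonneg _ _ (by positivity), mul_zero]
        congr 1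
        push_cast
        field_simp
      rw [h2, Real.norm_eq_abs, abs_le]
      have h3 : 0 < 1 / ((n : ℝ) + 1) := by positivity
      rcases max_cases (x - 1 / ((n : ℝ) + 1)) 0 with ⟨h4, h5⟩ | ⟨h4, h5⟩ <;> rw [h4] <;>
        constructor <;> linarith
    have haT : a * T = 0 := by
      rw [← norm_le_zero_iff]
      have h := (tendsto_one_div_add_atTop_nhds_zero_nat (𝕜 := ℝ)).const_mul ‖a‖
      rw [mul_zero] at h
      exact ge_of_tendsto' h hbound
    rw [mul_rangeProj_congr (b := 0) (by rw [haT, zero_mul]), zero_mul]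
  · have hn : (0 : ℝ) < (n + 1 : ℝ)⁻¹ := by positivity
    have hmax : ∀ x, max x (n + 1 : ℝ)⁻¹ ≠ 0 := fun x => (lt_max_of_lt_right hn).ne'
    have hk : Continuous fun x : ℝ => (max x (n + 1 : ℝ)⁻¹)⁻¹ :=
      (continuous_id.max continuous_const).inv₀ hmax
    set K := cfc (fun x : ℝ => (max x (n + 1 : ℝ)⁻¹)⁻¹) T with hK
    have hKT : K * T * F n = F n := by
      have h1 : K * T = cfc (fun x : ℝ => (max x (n + 1 : ℝ)⁻¹)⁻¹ * x) T := by
        rw [cfc_mul _ (fun x : ℝ => x) T hk.continuousOn continuousOn_id, hTid]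
      rw [h1, ← cfc_mul (fun x : ℝ => (max x (n + 1 : ℝ)⁻¹)⁻¹ * x) (f n) T
        (hk.mul continuous_id).continuousOn (hf n).continuousOn]
      refine cfc_congr fun x _ => ?_
      by_cases hx : f n x = 0
      · simp [hx]
      · obtain ⟨h1, h2⟩ := hfpos n x hx
        rw [max_eq_left h2, inv_mul_cancel₀ h1.ne', one_mul]
    refine ⟨‖K‖ + 1, by positivity, fun y => ?_⟩
    have h1 : K (T (rangeProj (F n) y)) = rangeProj (F n) y :=
      congr($(mul_rangeProj_eq_self hKT) y)
    calc ‖rangeProj (F n) y‖ = ‖K (T (rangeProj (F n) y))‖ := by rw [h1]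
      _ ≤ ‖K‖ * ‖T (rangeProj (F n) y)‖ := K.le_opNorm _
      _ ≤ _ := by gcongr; linarith

/-- If `S` is a norm limit of unitary conjugates of the positive operator `T`, the range projection
of `T` embeds into that of `S`. -/
theorem subEquiv_rangeProj {T S : H →L[ℂ] H} (hTM : T ∈ M) (hT : 0 ≤ T) (hSM : S ∈ M)
    (h : ∀ ε : ℝ, 0 < ε → ∃ u ∈ M, u ∈ unitary (H →L[ℂ] H) ∧ ‖star u * T * u - S‖ < ε) :
    SubEquiv M (rangeProj T) (rangeProj S) := by
  obtain ⟨p, hp, hbdd⟩ := exists_isExhaustion_rangeProj hTM hT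
  refine hp.subEquiv (isStarProjection_rangeProj S) (rangeProj_mem hSM) fun n => ?_
  obtain ⟨C, hC, hCp⟩ := hbdd n
  obtain ⟨u, huM, hu, huS⟩ := h C⁻¹ (by positivity)
  have hnu : ∀ x, ‖u x‖ = ‖x‖ :=
    fun x => star_mul_self_eq_iff (b := 1) |>.1 (by simpa using hu.1) x
  have hnu' : ∀ x, ‖star u x‖ = ‖x‖ :=
    fun x => star_mul_self_eq_iff (b := 1) |>.1 (by simpa using hu.2) x
  obtain ⟨v, hv, hvp, hvS⟩ := exists_polar_isometry (t := S * star u * p n)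
    (hp.isStarProjection n) (mul_mem (mul_mem hSM (star_mem huM)) (hp.mem n))
    (by rw [mul_assoc, (hp.isStarProjection n).isIdempotentElem.eq]) fun x hx => by
      have hx' : S (star u (p n x)) = 0 := hx
      by_contra hne
      have h1 : ‖T (p n x)‖ = ‖(star u * T * u - S) (star u (p n x))‖ := by
        have h2 : u (star u (p n x)) = p n x := congr($(hu.2) (p n x))
        change _ = ‖star u (T (u (star u (p n x)))) - S (star u (p n x))‖
        rw [hx', sub_zero, h2, hnu']
      have h2 : ‖T (p n x)‖ < C⁻¹ * ‖p n x‖ := by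
        rw [h1, ← hnu' (p n x)]
        refine (ContinuousLinearMap.le_opNorm _ _).trans_lt ?_
        gcongr
        rw [hnu']
        exact norm_pos_iff.2 hne
      have h3 := hCp x
      rw [inv_mul_eq_div, lt_div_iff₀ hC] at h2
      linarith
  exact ⟨v, hv, hvp, hvS _ (by rw [← mul_assoc, ← mul_assoc, rangeProj_mul])⟩

end RangeProjection

theorem stmt14 (A : Type*) [CStarAlgebra A]
    (H : Type*) [NormedAddCommGroup H] [InnerProductSpace ℂ H] [CompleteSpace H]
    (M : VonNeumannAlgebra H) (π ρ : A →⋆ₐ[ℂ] (H →L[ℂ] H))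
    (hπ : ∀ a, π a ∈ M) (hρ : ⇑ρ ∈ closure (unitaryOrbitVN M π)) :
    ∀ a : A, ∃ rπ rρ v : H →L[ℂ] H,
      IsRangeProjection rπ (π a) ∧ IsRangeProjection rρ (ρ a) ∧
      v ∈ M ∧ star v * v = rπ ∧ v * star v = rρ := by
  have hcl : ∀ b, ρ b ∈ closure {x | ∃ u ∈ M, u ∈ unitary (H →L[ℂ] H) ∧
      x = star u * π b * u} := fun b =>
    map_mem_closure (f := fun f : A → H →L[ℂ] H => f b) (continuous_apply b) hρ
      fun _ ⟨u, hu, hu', hf⟩ => ⟨u, hu, hu', congr($hf b)⟩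
  have happrox : ∀ b, ∀ ε : ℝ, 0 < ε →
      ∃ u ∈ M, u ∈ unitary (H →L[ℂ] H) ∧ ‖star u * π b * u - ρ b‖ < ε := fun b ε hε => by
    obtain ⟨_, ⟨u, hu, hu', rfl⟩, h⟩ := Metric.mem_closure_iff.1 (hcl b) ε hε
    exact ⟨u, hu, hu', by rwa [dist_comm, dist_eq_norm] at h⟩
  have hρM : ∀ b, ρ b ∈ M := fun b => mem_of_commute_commutant fun y hy => by
    refine closure_minimal (t := {x | y * x = x * y}) ?_
      (isClosed_eq (by fun_prop) (by fun_prop)) (hcl b)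
    rintro _ ⟨u, hu, -, rfl⟩
    exact commute_of_mem_commutant hy (mul_mem (mul_mem (star_mem hu) (hπ b)) hu)
  intro a
  have h1 : SubEquiv M (rangeProj (π a)) (rangeProj (ρ a)) := by
    have h := subEquiv_rangeProj (hπ (a * star a))
      (by rw [map_mul, map_star]; exact mul_star_self_nonneg _) (hρM (a * star a))
      (happrox (a * star a))
    simpa only [map_mul, map_star, rangeProj_mul_star_self] using h
  have h2 : SubEquiv M (rangeProj (ρ a)) (rangeProj (π a)) := by
    have h := subEquiv_rangeProj (hρM (a * star a))
      (by rw [map_mul, map_star]; exact mul_star_self_nonneg _) (hπ (a * star a)) fun ε hε => by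
        obtain ⟨u, hu, hu', h⟩ := happrox (a * star a) ε hε
        refine ⟨star u, star_mem hu, Unitary.star_mem hu', ?_⟩
        have h3 : star (star u) * ρ (a * star a) * star u - π (a * star a) =
            u * (ρ (a * star a) - star u * π (a * star a) * u) * star u := by
          have h4 : u * star u = 1 := hu'.2
          have h5 : u * (star u * π (a * star a) * u) * star u =
              (u * star u) * π (a * star a) * (u * star u) := by simp only [mul_assoc]
          rw [star_star, mul_sub, sub_mul, h5, h4, one_mul, mul_one]
        rw [h3, CStarRing.norm_mul_mem_unitary _ (Unitary.star_mem hu'),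
          CStarRing.norm_mem_unitary_mul _ hu', norm_sub_rev]
        exact h
    simpa only [map_mul, map_star, rangeProj_mul_star_self] using h
  obtain ⟨v, hv, hv1, hv2⟩ := SubEquiv.antisymm (isStarProjection_rangeProj _)
    (isStarProjection_rangeProj _) (rangeProj_mem (hπ a)) h1 h2
  exact ⟨_, _, v, isRangeProjection_rangeProj _, isRangeProjection_rangeProj _, hv, hv1, hv2⟩
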